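/- arXiv:1905.01903 — 3 statements merged into one kernel-verified Lean document; each statement's English description precedes it below -/
import Mathlib

section
/- Let the scaling coefficients satisfy s_C ≤ |C| - d for every color set C with |C| ≤ d/2. If M̃ is a connected submap of a connected decorated map M ∈ 𝕄({b_C}), then δ(M) ≤ δ(M̃); that is, δ is monotone decreasing under adding edges (non-increasing for inclusion of connected submaps). -/
attribute [local instance] Classical.propDecidable

open Function

/-- Number of orbits of a self-map: classes of the equivalence generated by `x ~ f x`. -/
noncomputable def numOrbits {D : Type*} (f : D → D) : ℕ :=
  Nat.card (Quotient (Relation.EqvGen.setoid fun x y => f x = y))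

/-- Connectivity of a combinatorial map given by its rotation `σ` and dart-reversal `α`. -/
def MapConnected {D : Type*} (σ α : D → D) : Prop :=
  ∀ x y : D, Relation.EqvGen (fun a b => σ a = b ∨ α a = b) x y

variable {D : Type*} [Fintype D] [DecidableEq D]

/-- Induced rotation on a subset of darts: first return of `σ` to `S`. -/
noncomputable def indSigma (σ : D → D) (S : Finset D) (y : {z : D // z ∈ S}) :
    {z : D // z ∈ S} :=
  if h : ∃ k : ℕ, 0 < k ∧ σ^[k] y.1 ∈ S then ⟨σ^[Nat.find h] y.1, (Nat.find_spec h).2⟩ else y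

/-- Restriction of the dart-reversal to a subset of darts. -/
noncomputable def indAlpha (α : D → D) (S : Finset D) (y : {z : D // z ∈ S}) :
    {z : D // z ∈ S} :=
  if h : α y.1 ∈ S then ⟨α y.1, h⟩ else y

/-- Face successor of a dart of the submap with dart set `S`: reverse the dart,
then take the first return of the rotation to `S`. -/
noncomputable def faceSucc (σ α : D → D) (S : Finset D) (x : {y : D // y ∈ S}) :
    {y : D // y ∈ S} :=
  if h : ∃ k : ℕ, 0 < k ∧ σ^[k] (α x.1) ∈ S then
    ⟨σ^[Nat.find h] (α x.1), (Nat.find_spec h).2⟩ else x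

/-- Number of vertices (σ-orbits) none of whose darts lies in `S`. -/
noncomputable def isolatedVerts (σ : D → D) (S : Finset D) : ℕ :=
  numOrbits (fun x : {y : D // ∀ k : ℕ, σ^[k] y ∉ S} =>
    ⟨σ x.1, fun k hk => x.2 (k + 1) (by rw [Function.iterate_succ_apply]; exact hk)⟩)

/-- Darts of the submap of color `c`. -/
def colorDarts {d : ℕ} (col : D → Finset (Fin d)) (c : Fin d) : Finset D :=
  Finset.univ.filter fun x => c ∈ col x

/-- Number of faces of color `c`, isolated vertices counting as one face each. -/
noncomputable def Fc {d : ℕ} (σ α : D → D) (col : D → Finset (Fin d)) (c : Fin d) : ℕ :=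
  numOrbits (faceSucc σ α (colorDarts col c)) + isolatedVerts σ (colorDarts col c)

/-- Number of edges decorated by the color set `C`. -/
def bCnt {d : ℕ} (col : D → Finset (Fin d)) (C : Finset (Fin d)) : ℕ :=
  (Finset.univ.filter fun x => col x = C).card / 2

/-- `δ(M) = Σ_c F_c(M) + Σ_C s_C b_C(M)`. -/
noncomputable def deltaMap {d : ℕ} (σ α : D → D) (col : D → Finset (Fin d))
    (s : Finset (Fin d) → ℤ) : ℤ :=
  (∑ c : Fin d, (Fc σ α col c : ℤ)) + ∑ C : Finset (Fin d), s C * (bCnt col C : ℤ)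

/-- A proper decorated map: `σ` is a permutation of the darts, `α` is a fixed-point-free
involution, the decoration is constant on edges, and the map is connected. -/
def ProperMap {d : ℕ} (σ α : D → D) (col : D → Finset (Fin d)) : Prop :=
  Function.Bijective σ ∧ (∀ x, α (α x) = x) ∧ (∀ x, α x ≠ x) ∧
    (∀ x, col (α x) = col x) ∧ MapConnected σ α

/-- Darts remaining after deleting the edge of the dart `x0`. -/
def delDarts (α : D → D) (x0 : D) : Finset D := Finset.univ \ {x0, α x0}

/-- The edge of the dart `x0` is a bridge: its deletion disconnects the map. -/
def IsBridgeDart (σ α : D → D) (x0 : D) : Prop :=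
  ¬ MapConnected (indSigma σ (delDarts α x0)) (indAlpha α (delDarts α x0))

/-- Unhooking the dart `x0` from its vertex: `x0` becomes a new univalent vertex. -/
def unhookSigma (σ : D → D) (x0 : D) : D → D :=
  fun y => if y = x0 then x0 else if σ y = x0 then σ x0 else σ y

theorem rel_lift {E β : Type*} {f : E → E} (g : E → β) (hg : ∀ x, g (f x) = g x) {x y : E}
    (h : Relation.EqvGen (fun x y => f x = y) x y) : g x = g y := by
  induction h with
  | rel a b h => rw [← h, hg]
  | refl a => rfl
  | symm a b _ ih => exact ih.symm
  | trans a b c _ _ h1 h2 => exact h1.trans h2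

theorem rel_iter {E : Type*} (f : E → E) (x : E) (k : ℕ) :
    Relation.EqvGen (fun x y => f x = y) x (f^[k] x) := by
  induction k with
  | zero => exact Relation.EqvGen.refl _
  | succ k ih =>
    rw [Function.iterate_succ_apply']
    exact ih.trans _ _ _ (Relation.EqvGen.rel _ _ rfl)

theorem exists_return {E : Type*} [Finite E] {f : E → E} (hf : Bijective f) (x : E) :
    ∃ n, f^[n] (f x) = x := by
  obtain ⟨n, hn, h⟩ := hf.injective.mem_periodicPts x
  obtain ⟨m, rfl⟩ : ∃ m, n = m + 1 := ⟨n - 1, by omega⟩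
  exact ⟨m, h⟩

/-- orbit class -/
def oqMk {E : Type*} (f : E → E) (x : E) :
    Quotient (Relation.EqvGen.setoid fun x y => f x = y) := Quotient.mk _ x

theorem oqMk_eq {E : Type*} {f : E → E} {x y : E} :
    oqMk f x = oqMk f y ↔ Relation.EqvGen (fun x y => f x = y) x y := by
  unfold oqMk
  rw [Quotient.eq]; rfl

theorem oqMk_step {E : Type*} (f : E → E) (x : E) : oqMk f (f x) = oqMk f x :=
  (oqMk_eq.2 (Relation.EqvGen.rel _ _ rfl)).symm

theorem oqMk_iter {E : Type*} (f : E → E) (x : E) (k : ℕ) : oqMk f (f^[k] x) = oqMk f x :=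
  (oqMk_eq.2 (rel_iter f x k)).symm

theorem oqMk_surj {E : Type*} (f : E → E) : Function.Surjective (oqMk f) := Quotient.mk_surjective

/-- lift of an invariant function -/
def oqLift {E β : Type*} (f : E → E) (g : E → β) (hg : ∀ x, g (f x) = g x) :
    Quotient (Relation.EqvGen.setoid fun x y => f x = y) → β :=
  Quotient.lift g fun _ _ h => rel_lift g hg h

theorem oqLift_mk {E β : Type*} (f : E → E) (g : E → β) (hg : ∀ x, g (f x) = g x) (x : E) :
    oqLift f g hg (oqMk f x) = g x := rfl

theorem orb_swap_le {E : Type*} [Finite E] [DecidableEq E] (f : E → E) (a b : E) :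
    numOrbits (f ∘ Equiv.swap a b) ≤ numOrbits f + 1 := by
  set f' := f ∘ Equiv.swap a b with hf'
  have ha : f' a = f b := by simp [hf']
  have hb : f' b = f a := by simp [hf']
  have hx : ∀ x, x ≠ a → x ≠ b → f' x = f x := fun x h1 h2 => by
    simp [hf', Equiv.swap_apply_of_ne_of_ne h1 h2]
  let h : Quotient (Relation.EqvGen.setoid fun x y => f' x = y) →
      Quotient (Relation.EqvGen.setoid fun x y => f' x = y) :=
    fun q => if q = oqMk f' b then oqMk f' a else q
  have hg : ∀ x, h (oqMk f' (f x)) = h (oqMk f' x) := by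
    intro x
    by_cases h1 : x = a
    · subst h1
      rw [← hb, oqMk_step]
      simp only [h]; split_ifs <;> simp_all
    by_cases h2 : x = b
    · subst h2
      rw [← ha, oqMk_step]
      simp only [h]; split_ifs <;> simp_all
    rw [← hx x h1 h2, oqMk_step]
  unfold numOrbits
  rw [← Finite.card_option]
  refine Nat.card_le_card_of_surjective
    (fun o => Option.elim o (oqMk f' b) (oqLift f (fun x => h (oqMk f' x)) hg)) ?_
  intro q
  obtain ⟨x, rfl⟩ := oqMk_surj _ q
  by_cases hq : oqMk f' x = oqMk f' b
  · exact ⟨none, hq.symm⟩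
  · exact ⟨some (oqMk f x), by simp [oqLift_mk, h, hq]⟩

theorem orb_swap_lt {E : Type*} [Finite E] [DecidableEq E] (f : E → E) (hf : Bijective f)
    (a b : E) (hab : oqMk f a ≠ oqMk f b) :
    numOrbits (f ∘ Equiv.swap a b) + 1 ≤ numOrbits f := by
  set f' := f ∘ Equiv.swap a b with hf'
  have ha : f' a = f b := by simp [hf']
  have hb : f' b = f a := by simp [hf']
  have hx : ∀ x, x ≠ a → x ≠ b → f' x = f x := fun x h1 h2 => by
    simp [hf', Equiv.swap_apply_of_ne_of_ne h1 h2]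
  have key : oqMk f' a = oqMk f' b := by
    by_contra hne
    have : ∀ n, oqMk f' (f^[n] (f b)) = oqMk f' a := by
      intro n
      induction n with
      | zero => rw [Function.iterate_zero_apply, ← ha, oqMk_step]
      | succ n ih =>
        rw [Function.iterate_succ_apply']
        rw [← hx, oqMk_step, ih]
        · intro h
          apply hab
          rw [← h, oqMk_iter, oqMk_step]
        · intro h
          rw [h] at ih
          exact hne ih.symm
    obtain ⟨n, hn⟩ := exists_return hf b
    have := this n
    rw [hn] at this
    exact hne this.symm
  have hg : ∀ x, oqMk f' (f x) = oqMk f' x := by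
    intro x
    by_cases h1 : x = a
    · subst h1
      rw [← hb, oqMk_step, key]
    by_cases h2 : x = b
    · subst h2
      rw [← ha, oqMk_step, key]
    rw [← hx x h1 h2, oqMk_step]
  have hs : Function.Surjective (oqLift f (oqMk f') hg) := by
    intro q
    obtain ⟨x, rfl⟩ := oqMk_surj _ q
    exact ⟨oqMk f x, rfl⟩
  unfold numOrbits
  by_contra hlt
  have hle := Nat.card_le_card_of_surjective _ hs
  have heq : Nat.card (Quotient (Relation.EqvGen.setoid fun x y => f x = y)) =
    Nat.card (Quotient (Relation.EqvGen.setoid fun x y => f' x = y)) := by omega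
  have hbij := (Nat.bijective_iff_surjective_and_card (oqLift f (oqMk f') hg)).2 ⟨hs, heq⟩
  exact hab (hbij.1 key)

section
variable {E : Type*} [Fintype E] [DecidableEq E]

theorem indSigma_spec {f : E → E} (hf : Bijective f) (T : Finset E) (y : {z // z ∈ T}) :
    ∃ k, f^[k+1] y.1 = (indSigma f T y).1 ∧ ∀ j < k, f^[j+1] y.1 ∉ T := by
  have h : ∃ k : ℕ, 0 < k ∧ f^[k] y.1 ∈ T := by
    obtain ⟨n, hn⟩ := exists_return hf y.1
    exact ⟨n+1, by omega, by rw [Function.iterate_succ_apply, hn]; exact y.2⟩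
  unfold indSigma
  rw [dif_pos h]
  have h1 := Nat.find_spec h
  obtain ⟨m, hm⟩ : ∃ m, Nat.find h = m + 1 := ⟨Nat.find h - 1, by omega⟩
  refine ⟨m, by simp only [hm], fun j hj hT => ?_⟩
  exact Nat.find_min h (m := j+1) (by omega) ⟨by omega, hT⟩

theorem hit_unique {f : E → E} {T : Finset E} {x u v : E} {k l : ℕ}
    (h1 : f^[k] x = u) (h2 : ∀ j < k, f^[j] x ∉ T) (hu : u ∈ T)
    (h3 : f^[l] x = v) (h4 : ∀ j < l, f^[j] x ∉ T) (hv : v ∈ T) : u = v := by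
  rcases lt_trichotomy k l with h | h | h
  · exact absurd (h1 ▸ hu) (h4 k h)
  · subst h; exact h1.symm.trans h3
  · exact absurd (h3 ▸ hv) (h2 l h)

theorem iter_agree {f g : E → E} {T : Finset E} (hfg : ∀ x, x ∉ T → f x = g x) {x : E} :
    ∀ {k : ℕ}, (∀ j < k, f^[j] x ∉ T) → f^[k] x = g^[k] x := by
  intro k
  induction k with
  | zero => intro _; rfl
  | succ k ih =>
    intro h
    rw [Function.iterate_succ_apply', Function.iterate_succ_apply',
      ← ih (fun j hj => h j (by omega)), hfg _ (h k (by omega))]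

theorem hit_agree {f g : E → E} {T : Finset E} (hfg : ∀ x, x ∉ T → f x = g x) {x u v : E} {k l : ℕ}
    (h1 : f^[k] x = u) (h2 : ∀ j < k, f^[j] x ∉ T) (hu : u ∈ T)
    (h3 : g^[l] x = v) (h4 : ∀ j < l, g^[j] x ∉ T) (hv : v ∈ T) : u = v := by
  refine hit_unique (f := g) (T := T) (k := k) (l := l) (x := x) ?_ ?_ hu h3 h4 hv
  · rw [← iter_agree hfg h2]; exact h1
  · intro j hj
    rw [← iter_agree hfg (fun i hi => h2 i (by omega))]; exact h2 j hj

/-- the isolated part self-map -/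
abbrev isoStep (f : E → E) (T : Finset E) (x : {y : E // ∀ k : ℕ, f^[k] y ∉ T}) :
    {y : E // ∀ k : ℕ, f^[k] y ∉ T} :=
  ⟨f x.1, fun k hk => x.2 (k + 1) (by rw [Function.iterate_succ_apply]; exact hk)⟩

theorem isolatedVerts_eq (f : E → E) (T : Finset E) :
    isolatedVerts f T = numOrbits (isoStep f T) := rfl

theorem isoStep_iter (f : E → E) (T : Finset E) (x : {y : E // ∀ k : ℕ, f^[k] y ∉ T}) (k : ℕ) :
    ((isoStep f T)^[k] x).1 = f^[k] x.1 := by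
  induction k with
  | zero => rfl
  | succ k ih => rw [Function.iterate_succ_apply', Function.iterate_succ_apply', ← ih]

/-- First hit class. -/
noncomputable def hitCls (f : E → E) (T : Finset E) (x : E) :
    Quotient (Relation.EqvGen.setoid fun x y => indSigma f T x = y) ⊕
    Quotient (Relation.EqvGen.setoid fun x y => isoStep f T x = y) :=
  if h : ∃ k : ℕ, f^[k] x ∈ T then Sum.inl (oqMk _ ⟨f^[Nat.find h] x, Nat.find_spec h⟩)
  else Sum.inr (oqMk _ ⟨x, fun k hk => h ⟨k, hk⟩⟩)

theorem hitCls_inl (f : E → E) (T : Finset E) (x : E) (u : {z // z ∈ T}) (k : ℕ)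
    (h1 : f^[k] x = u.1) (h2 : ∀ j < k, f^[j] x ∉ T) :
    hitCls f T x = Sum.inl (oqMk _ u) := by
  have h : ∃ k : ℕ, f^[k] x ∈ T := ⟨k, by rw [h1]; exact u.2⟩
  unfold hitCls
  rw [dif_pos h]
  congr 2
  apply Subtype.ext
  exact hit_unique rfl (fun j hj => Nat.find_min h hj) (Nat.find_spec h) h1 h2 u.2

theorem hitCls_inr (f : E → E) (T : Finset E) (x : {y : E // ∀ k : ℕ, f^[k] y ∉ T}) :
    hitCls f T x.1 = Sum.inr (oqMk _ x) := by
  unfold hitCls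
  rw [dif_neg]
  rintro ⟨k, hk⟩
  exact x.2 k hk

theorem exists_first {f : E → E} {T : Finset E} {x : E} (h : ∃ k : ℕ, f^[k] x ∈ T) :
    ∃ k : ℕ, f^[k] x ∈ T ∧ ∀ j < k, f^[j] x ∉ T :=
  ⟨Nat.find h, Nat.find_spec h, fun _ hj => Nat.find_min h hj⟩

theorem hits_step {f : E → E} (hf : Bijective f) (T : Finset E) (x : E) :
    (∃ k, f^[k] (f x) ∈ T) ↔ ∃ k, f^[k] x ∈ T := by
  constructor
  · rintro ⟨k, hk⟩
    exact ⟨k+1, hk⟩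
  · rintro ⟨k, hk⟩
    obtain ⟨n, hn⟩ := exists_return hf x
    exact ⟨k + n, by rw [Function.iterate_add_apply, hn]; exact hk⟩

theorem hitCls_step {f : E → E} (hf : Bijective f) (T : Finset E) (x : E) :
    hitCls f T (f x) = hitCls f T x := by
  by_cases h : ∃ k : ℕ, f^[k] x ∈ T
  · by_cases hx : x ∈ T
    · obtain ⟨k, h1, h2⟩ := indSigma_spec hf T ⟨x, hx⟩
      rw [hitCls_inl f T (f x) (indSigma f T ⟨x, hx⟩) k h1 h2,
        hitCls_inl f T x ⟨x, hx⟩ 0 rfl (by simp), oqMk_step]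
    · obtain ⟨k, h1, h2⟩ := exists_first h
      cases k with
      | zero => exact absurd h1 hx
      | succ k =>
        rw [hitCls_inl f T x ⟨_, h1⟩ (k+1) rfl h2,
          hitCls_inl f T (f x) ⟨_, h1⟩ k rfl (fun j hj => h2 (j+1) (by omega))]
  · push Not at h
    rw [hitCls_inr f T ⟨x, h⟩, hitCls_inr f T (isoStep f T ⟨x, h⟩), oqMk_step]

theorem orb_split {f : E → E} (hf : Bijective f) (T : Finset E) :
    numOrbits f = numOrbits (indSigma f T) + isolatedVerts f T := by
  rw [isolatedVerts_eq]
  unfold numOrbits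
  rw [← Nat.card_sum]
  refine Nat.card_eq_of_bijective (oqLift f (hitCls f T) (hitCls_step hf T)) ⟨?_, ?_⟩
  · intro p q hpq
    obtain ⟨x, rfl⟩ := oqMk_surj _ p
    obtain ⟨y, rfl⟩ := oqMk_surj _ q
    let g : (Quotient (Relation.EqvGen.setoid fun x y => indSigma f T x = y) ⊕
      Quotient (Relation.EqvGen.setoid fun x y => isoStep f T x = y)) →
      Quotient (Relation.EqvGen.setoid fun x y => f x = y) :=
      Sum.elim
        (oqLift (indSigma f T) (fun z => oqMk f z.1) (fun z => by
          obtain ⟨k, h1, h2⟩ := indSigma_spec hf T z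
          rw [← h1, oqMk_iter]))
        (oqLift (isoStep f T) (fun z => oqMk f z.1) (fun z => oqMk_step _ _))
    have hg : ∀ x, g (hitCls f T x) = oqMk f x := by
      intro x
      by_cases h : ∃ k : ℕ, f^[k] x ∈ T
      · obtain ⟨k, h1, h2⟩ := exists_first h
        rw [hitCls_inl f T x ⟨_, h1⟩ k rfl h2]
        exact oqMk_iter f x k
      · push Not at h
        rw [hitCls_inr f T ⟨x, h⟩]
        rfl
    have := congrArg g hpq
    rwa [oqLift_mk, oqLift_mk, hg, hg] at this
  · rintro (q | q)
    · obtain ⟨x, rfl⟩ := oqMk_surj _ q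
      exact ⟨oqMk f x.1, hitCls_inl f T x.1 x 0 rfl (by simp)⟩
    · obtain ⟨x, rfl⟩ := oqMk_surj _ q
      exact ⟨oqMk f x.1, hitCls_inr f T x⟩

theorem iso_le {f g : E → E} {T : Finset E} (hfg : ∀ x, x ∉ T → f x = g x) :
    isolatedVerts f T ≤ isolatedVerts g T := by
  rw [isolatedVerts_eq, isolatedVerts_eq]
  have h1 : ∀ x : E, (∀ k, g^[k] x ∉ T) → ∀ k, f^[k] x ∉ T := by
    intro x hx k
    rw [← iter_agree (f := g) (g := f) (T := T) (fun x hx => (hfg x hx).symm) (fun j _ => hx j)]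
    exact hx k
  have h2 : ∀ x : E, (∀ k, f^[k] x ∉ T) → ∀ k, g^[k] x ∉ T := by
    intro x hx k
    rw [← iter_agree (f := f) (g := g) (T := T) hfg (fun j _ => hx j)]
    exact hx k
  refine Nat.card_le_card_of_surjective
    (oqLift (isoStep g T) (fun z => oqMk (isoStep f T) ⟨z.1, h1 _ z.2⟩) ?_) ?_
  · intro z
    rw [← oqMk_step (isoStep f T) ⟨z.1, _⟩]
    congr 1
    exact Subtype.ext (hfg z.1 (z.2 0)).symm
  · intro q
    obtain ⟨x, rfl⟩ := oqMk_surj _ q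
    exact ⟨oqMk _ ⟨x.1, h2 _ x.2⟩, rfl⟩

theorem iso_congr {f g : E → E} {T : Finset E} (hfg : ∀ x, x ∉ T → f x = g x) :
    isolatedVerts f T = isolatedVerts g T :=
  le_antisymm (iso_le hfg) (iso_le fun x hx => (hfg x hx).symm)

theorem iso_univ (f : E → E) : isolatedVerts f Finset.univ = 0 := by
  rw [isolatedVerts_eq]
  unfold numOrbits
  rw [Nat.card_eq_zero]
  left
  refine ⟨fun q => ?_⟩
  obtain ⟨x, rfl⟩ := oqMk_surj _ q
  exact x.2 0 (Finset.mem_univ _)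

theorem iso_stepA (f : E → E) {S S' : Finset E} (hSS : S ⊆ S')
    (h : ∀ x ∈ S', ∃ k, f^[k] x ∈ S) : isolatedVerts f S ≤ isolatedVerts f S' := by
  rw [isolatedVerts_eq, isolatedVerts_eq]
  refine Nat.card_le_card_of_surjective
    (oqLift (isoStep f S') (fun z => oqMk (isoStep f S) ⟨z.1, fun k hk => z.2 k (hSS hk)⟩)
      (fun z => oqMk_step (isoStep f S) ⟨z.1, _⟩)) ?_
  intro q
  obtain ⟨x, rfl⟩ := oqMk_surj _ q
  refine ⟨oqMk _ ⟨x.1, fun k hk => ?_⟩, rfl⟩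
  obtain ⟨m, hm⟩ := h _ hk
  rw [← Function.iterate_add_apply] at hm
  exact x.2 _ hm

theorem iso_stepB (f : E → E) {S S' : Finset E} (hSS : S ⊆ S') (a : E) (ha : ∀ k, f^[k] a ∉ S)
    (h : ∀ x ∈ S', x = a ∨ ∃ k, f^[k] x ∈ S) : isolatedVerts f S ≤ isolatedVerts f S' + 1 := by
  rw [isolatedVerts_eq, isolatedVerts_eq]
  unfold numOrbits
  rw [← Finite.card_option]
  refine Nat.card_le_card_of_surjective
    (fun o => Option.elim o (oqMk (isoStep f S) ⟨a, ha⟩) (oqLift (isoStep f S')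
      (fun z => oqMk (isoStep f S) ⟨z.1, fun k hk => z.2 k (hSS hk)⟩)
      (fun z => oqMk_step (isoStep f S) ⟨z.1, _⟩))) ?_
  intro q
  obtain ⟨x, rfl⟩ := oqMk_surj _ q
  by_cases hx : ∀ k, f^[k] x.1 ∉ S'
  · exact ⟨some (oqMk _ ⟨x.1, hx⟩), rfl⟩
  · push Not at hx
    obtain ⟨k, hk⟩ := hx
    refine ⟨none, ?_⟩
    rcases h _ hk with h | ⟨m, hm⟩
    · rw [← oqMk_iter (isoStep f S) x k]
      show oqMk _ _ = _
      congr 1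
      apply Subtype.ext
      rw [isoStep_iter, h]
    · rw [← Function.iterate_add_apply] at hm
      exact absurd hm (x.2 _)

/-- `α` restricted to `T`, identity elsewhere. -/
noncomputable def resA (α : E → E) (T : Finset E) (x : E) : E := if x ∈ T then α x else x

theorem resA_bij {α : E → E} (hα : ∀ x, α (α x) = x) {T : Finset E} (hT : ∀ x ∈ T, α x ∈ T) :
    Bijective (resA α T) := by
  apply Function.Involutive.bijective
  intro x
  unfold resA
  by_cases h : x ∈ T
  · rw [if_pos h, if_pos (hT x h), hα]
  · rw [if_neg h, if_neg h]

theorem faceSucc_eq {σ α : E → E} (hσ : Bijective σ) (hα : ∀ x, α (α x) = x) {T : Finset E}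
    (hT : ∀ x ∈ T, α x ∈ T) :
    faceSucc σ α T = indSigma (σ ∘ resA α T) T := by
  funext x
  have h : ∃ k : ℕ, 0 < k ∧ σ^[k] (α x.1) ∈ T := by
    obtain ⟨n, hn⟩ := exists_return hσ (α x.1)
    exact ⟨n+1, by omega, by rw [Function.iterate_succ_apply, hn]; exact hT _ x.2⟩
  obtain ⟨k, h1, h2⟩ := indSigma_spec (hσ.comp (resA_bij hα hT)) T x
  apply Subtype.ext
  unfold faceSucc
  rw [dif_pos h]
  have h0 := Nat.find_spec h
  obtain ⟨m, hm⟩ : ∃ m, Nat.find h = m + 1 := ⟨Nat.find h - 1, by omega⟩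
  have e : (σ ∘ resA α T) x.1 = σ (α x.1) := by simp [resA, x.2]
  simp only [Function.iterate_succ_apply, e] at h1 h2
  refine hit_agree (f := σ) (g := σ ∘ resA α T) (T := T) (x := σ (α x.1)) (k := m) (l := k)
    ?_ ?_ ?_ ?_ h1 h2 (Subtype.prop _)
  · intro z hz; simp [resA, hz]
  · simp only [hm]; rfl
  · intro j hj hT
    exact Nat.find_min h (m := j+1) (by omega) ⟨by omega, hT⟩
  · exact h0.2

theorem Fc_eq {d : ℕ} {σ α : E → E} (hσ : Bijective σ) (hα : ∀ x, α (α x) = x)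
    {col : E → Finset (Fin d)} (hc : ∀ x, col (α x) = col x) (c : Fin d) :
    Fc σ α col c = numOrbits (σ ∘ resA α (colorDarts col c)) := by
  have hT : ∀ x ∈ colorDarts col c, α x ∈ colorDarts col c := by
    intro x; simp [colorDarts, hc]
  rw [orb_split (hσ.comp (resA_bij hα hT)) (colorDarts col c)]
  unfold Fc
  rw [faceSucc_eq hσ hα hT]
  congr 1
  apply iso_congr
  intro z hz; simp [resA, hz]

theorem indSigma_bij {f : E → E} (hf : Bijective f) (T : Finset E) : Bijective (indSigma f T) := by
  rw [← Finite.injective_iff_bijective]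
  have key : ∀ (x y : {z // z ∈ T}) (k l : ℕ), k ≤ l → f^[k+1] x.1 = f^[l+1] y.1 →
      (∀ j < l, f^[j+1] y.1 ∉ T) → x = y := by
    intro x y k l hkl h h4
    obtain ⟨m, rfl⟩ := Nat.exists_eq_add_of_le hkl
    have e : k + m + 1 = (k + 1) + m := by omega
    rw [e, Function.iterate_add_apply f (k + 1) m] at h
    have h' := hf.injective.iterate _ h
    cases m with
    | zero => exact Subtype.ext h'
    | succ m => exact absurd (h' ▸ x.2) (h4 m (by omega))
  intro x y hxy
  obtain ⟨k, h1, h2⟩ := indSigma_spec hf T x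
  obtain ⟨l, h3, h4⟩ := indSigma_spec hf T y
  rw [hxy] at h1
  rcases le_total k l with h | h
  · exact key x y k l h (h1.trans h3.symm) h4
  · exact (key y x l k h (h3.trans h1.symm) h2).symm

theorem sub_first {σ α : E → E} (hσ : Bijective σ) (hα : ∀ x, α (α x) = x) {S T : Finset E}
    (hS : ∀ x ∈ S, α x ∈ S) (hT : ∀ x ∈ T, α x ∈ T) (T' : Finset {z // z ∈ S})
    (hTT : ∀ x : {z // z ∈ S}, x ∈ T' ↔ x.1 ∈ T) (hTS : T ⊆ S) :
    indSigma σ S ∘ resA (indAlpha α S) T' = indSigma (σ ∘ resA α T) S := by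
  funext x
  have e : (resA (indAlpha α S) T' x).1 = resA α T x.1 := by
    unfold resA
    by_cases h : x.1 ∈ T
    · rw [if_pos ((hTT x).2 h), if_pos h]; simp [indAlpha, hS _ x.2]
    · rw [if_neg (fun h' => h ((hTT x).1 h')), if_neg h]
  obtain ⟨k, h1, h2⟩ := indSigma_spec (hσ.comp (resA_bij hα hT)) S x
  obtain ⟨l, h3, h4⟩ := indSigma_spec hσ S (resA (indAlpha α S) T' x)
  apply Subtype.ext
  simp only [Function.iterate_succ_apply, e] at h3 h4
  simp only [Function.iterate_succ_apply] at h1 h2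
  refine hit_agree (f := σ) (g := σ ∘ resA α T) (T := S) (x := σ (resA α T x.1))
    ?_ h3 h4 (Subtype.prop _) h1 h2 (Subtype.prop _)
  intro z hz
  have : z ∉ T := fun h => hz (hTS h)
  simp [resA, this]

theorem Fc_sub {d : ℕ} {σ α : E → E} (hσ : Bijective σ) (hα : ∀ x, α (α x) = x)
    {col : E → Finset (Fin d)} (hc : ∀ x, col (α x) = col x) (c : Fin d) {S : Finset E}
    (hS : ∀ x ∈ S, α x ∈ S) :
    Fc (indSigma σ S) (indAlpha α S) (fun y => col y.1) c + isolatedVerts σ S =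
      numOrbits (σ ∘ resA α (S.filter fun x => c ∈ col x)) := by
  have hA : ∀ x : {z // z ∈ S}, (indAlpha α S x).1 = α x.1 := by
    intro x; simp [indAlpha, hS _ x.2]
  have hT : ∀ x ∈ S.filter (fun x => c ∈ col x), α x ∈ S.filter (fun x => c ∈ col x) := by
    intro x hx
    rw [Finset.mem_filter] at hx ⊢
    exact ⟨hS _ hx.1, by rw [hc]; exact hx.2⟩
  rw [Fc_eq (indSigma_bij hσ S) (fun x => Subtype.ext (by rw [hA, hA, hα]))
    (fun x => by simp only [hA, hc])]
  rw [orb_split (hσ.comp (resA_bij hα hT)) S, sub_first hσ hα hS hT _ _ (Finset.filter_subset _ _)]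
  · congr 1
    apply iso_congr
    intro z hz; simp [resA, hz]
  · intro x; simp [colorDarts, x.2]

theorem resA_swap {σ α : E → E} (hα : ∀ x, α (α x) = x) (hne : ∀ x, α x ≠ x)
    {T T' : Finset E} {x : E} (hx : x ∉ T) (hx' : α x ∉ T)
    (hT' : ∀ y, y ∈ T' ↔ y ∈ T ∨ y = x ∨ y = α x) :
    σ ∘ resA α T' = (σ ∘ resA α T) ∘ Equiv.swap x (α x) := by
  funext y
  simp only [Function.comp_apply]
  congr 1
  by_cases h1 : y = x
  · subst h1
    simp [resA, hT', hx']
  by_cases h2 : y = α x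
  · subst h2
    simp [resA, hT', hx, hα]
  rw [Equiv.swap_apply_of_ne_of_ne h1 h2]
  simp [resA, hT', h1, h2]

/-- The potential. -/
noncomputable def pot {d : ℕ} (σ α : E → E) (col : E → Finset (Fin d))
    (s : Finset (Fin d) → ℤ) (S : Finset E) : ℤ :=
  (∑ c : Fin d, ((numOrbits (σ ∘ resA α (S.filter fun x => c ∈ col x)) : ℤ)
      - (isolatedVerts σ S : ℤ))) +
    ∑ C : Finset (Fin d), s C * (((S.filter fun x => col x = C).card / 2 : ℕ) : ℤ)

theorem pot_sub {d : ℕ} {σ α : E → E} (hσ : Bijective σ) (hα : ∀ x, α (α x) = x)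
    {col : E → Finset (Fin d)} (hc : ∀ x, col (α x) = col x) (s : Finset (Fin d) → ℤ)
    {S : Finset E} (hS : ∀ x ∈ S, α x ∈ S) :
    deltaMap (indSigma σ S) (indAlpha α S) (fun y => col y.1) s = pot σ α col s S := by
  unfold deltaMap pot
  congr 1
  · refine Finset.sum_congr rfl fun c _ => ?_
    rw [← Fc_sub hσ hα hc c hS]
    push_cast; ring
  · refine Finset.sum_congr rfl fun C _ => ?_
    unfold bCnt
    congr 3
    refine Finset.card_bij (fun x _ => x.1) ?_ ?_ ?_
    · intro x hx
      simp at hx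
      simp [hx, x.2]
    · intro x _ y _ h; exact Subtype.ext h
    · intro y hy
      simp at hy
      exact ⟨⟨y, hy.1⟩, by simp [hy.2], rfl⟩

theorem pot_univ {d : ℕ} {σ α : E → E} (hσ : Bijective σ) (hα : ∀ x, α (α x) = x)
    {col : E → Finset (Fin d)} (hc : ∀ x, col (α x) = col x) (s : Finset (Fin d) → ℤ) :
    deltaMap σ α col s = pot σ α col s Finset.univ := by
  unfold deltaMap pot
  rw [iso_univ]
  congr 1
  · refine Finset.sum_congr rfl fun c _ => ?_
    rw [Fc_eq hσ hα hc]
    simp [colorDarts]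

theorem pot_step {d : ℕ} {σ α : E → E} (hσ : Bijective σ) (hα : ∀ x, α (α x) = x)
    (hne : ∀ x, α x ≠ x)
    {col : E → Finset (Fin d)} (hc : ∀ x, col (α x) = col x) (s : Finset (Fin d) → ℤ)
    (hs : ∀ C : Finset (Fin d), 2 * C.card ≤ d → s C ≤ (C.card : ℤ) - d)
    (hsize : ∀ y, 2 * (col y).card ≤ d)
    {S : Finset E} (hS : ∀ x ∈ S, α x ∈ S) {x : E} (hx : x ∉ S) (hxS : ∃ k, σ^[k] x ∈ S) :
    pot σ α col s (S ∪ {x, α x}) ≤ pot σ α col s S := by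
  have hx' : α x ∉ S := fun h => hx (by have := hS _ h; rwa [hα] at this)
  set S' := S ∪ {x, α x} with hS'
  have hmem : ∀ y, y ∈ S' ↔ y ∈ S ∨ y = x ∨ y = α x := by intro y; simp [hS']; tauto
  have hSS : S ⊆ S' := Finset.subset_union_left
  have hedge : ∑ C : Finset (Fin d), s C * (((S'.filter fun x => col x = C).card / 2 : ℕ) : ℤ)
      = ∑ C : Finset (Fin d), s C * (((S.filter fun x => col x = C).card / 2 : ℕ) : ℤ)
        + s (col x) := by
    have : s (col x) = ∑ C : Finset (Fin d), if C = col x then s C else 0 := by simp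
    rw [this, ← Finset.sum_add_distrib]
    refine Finset.sum_congr rfl fun C _ => ?_
    by_cases hC : C = col x
    · subst hC
      have : (S'.filter fun y => col y = col x) = (S.filter fun y => col y = col x) ∪ {x, α x} := by
        ext y
        simp only [Finset.mem_filter, hmem, Finset.mem_union, Finset.mem_insert,
          Finset.mem_singleton]
        constructor
        · rintro ⟨h | h, h'⟩
          · exact Or.inl ⟨h, h'⟩
          · exact Or.inr h
        · rintro (⟨h, h'⟩ | h)
          · exact ⟨Or.inl h, h'⟩
          · refine ⟨Or.inr h, ?_⟩
            rcases h with rfl | rfl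
            · rfl
            · exact hc x
      rw [this, Finset.card_union_of_disjoint, Finset.card_pair (hne x).symm,
        Nat.add_div_right _ (by norm_num), if_pos rfl]
      · push_cast; ring
      · simp [Finset.disjoint_left]
        intro y hy _
        refine ⟨fun h => hx (h ▸ hy), fun h => hx' (h ▸ hy)⟩
    · have : (S'.filter fun y => col y = C) = (S.filter fun y => col y = C) := by
        ext y
        simp only [Finset.mem_filter, hmem]
        constructor
        · rintro ⟨h | h, h'⟩
          · exact ⟨h, h'⟩
          · exfalso
            rcases h with rfl | rfl
            · exact hC h'.symm
            · exact hC (by rw [← h', hc])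
        · rintro ⟨h, h'⟩
          exact ⟨Or.inl h, h'⟩
      rw [this, if_neg hC, add_zero]
  have hout : ∀ c, c ∉ col x → (S'.filter fun y => c ∈ col y) = S.filter fun y => c ∈ col y := by
    intro c hcx
    ext y
    simp only [Finset.mem_filter, hmem]
    constructor
    · rintro ⟨h | h, h'⟩
      · exact ⟨h, h'⟩
      · exfalso
        rcases h with rfl | rfl
        · exact hcx h'
        · rw [hc] at h'; exact hcx h'
    · rintro ⟨h, h'⟩
      exact ⟨Or.inl h, h'⟩
  have hin : ∀ c, c ∈ col x → σ ∘ resA α (S'.filter fun y => c ∈ col y) =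
      (σ ∘ resA α (S.filter fun y => c ∈ col y)) ∘ Equiv.swap x (α x) := by
    intro c hcx
    refine resA_swap hα hne (by simp [hx]) (by simp [hx']) ?_
    intro y
    simp only [Finset.mem_filter, hmem]
    constructor
    · rintro ⟨h | h, h'⟩
      · exact Or.inl ⟨h, h'⟩
      · exact Or.inr h
    · rintro (⟨h, h'⟩ | h)
      · exact ⟨Or.inl h, h'⟩
      · refine ⟨Or.inr h, ?_⟩
        rcases h with rfl | rfl
        · exact hcx
        · rw [hc]; exact hcx
  have hTcl : ∀ c, ∀ x ∈ S.filter (fun x => c ∈ col x), α x ∈ S.filter (fun x => c ∈ col x) := by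
    intro c x hx
    rw [Finset.mem_filter] at hx ⊢
    exact ⟨hS _ hx.1, by rw [hc]; exact hx.2⟩
  have hsx := hs (col x) (hsize x)
  have hzx : (2 * (col x).card : ℤ) ≤ d := by exact_mod_cast hsize x
  have hsum1 : ∑ c : Fin d, (if c ∈ col x then (1 : ℤ) else 0) = (col x).card := by simp
  unfold pot
  rw [hedge]
  by_cases hB : ∃ k, σ^[k] (α x) ∈ S
  · have hV : (isolatedVerts σ S : ℤ) ≤ isolatedVerts σ S' := by
      have := iso_stepA σ hSS (fun y hy => by
        rcases (hmem y).1 hy with h | rfl | rfl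
        · exact ⟨0, h⟩
        · exact hxS
        · exact hB)
      exact_mod_cast this
    have := Finset.sum_le_sum (s := Finset.univ) (fun (c : Fin d) _ =>
      show ((numOrbits (σ ∘ resA α (S'.filter fun x => c ∈ col x)) : ℤ)
        - (isolatedVerts σ S' : ℤ)) ≤ ((numOrbits (σ ∘ resA α (S.filter fun x => c ∈ col x)) : ℤ)
        - (isolatedVerts σ S : ℤ)) + (if c ∈ col x then (1 : ℤ) else 0) from by
      split_ifs with h
      · rw [hin c h]
        have := orb_swap_le (σ ∘ resA α (S.filter fun y => c ∈ col y)) x (α x)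
        zify at this
        linarith
      · rw [hout c h]; linarith)
    rw [Finset.sum_add_distrib, hsum1] at this
    linarith
  · have hV : (isolatedVerts σ S : ℤ) ≤ isolatedVerts σ S' + 1 := by
      have := iso_stepB σ hSS (α x) (fun k hk => hB ⟨k, hk⟩) (fun y hy => by
        rcases (hmem y).1 hy with h | rfl | rfl
        · exact Or.inr ⟨0, h⟩
        · exact Or.inr hxS
        · exact Or.inl rfl)
      exact_mod_cast this
    have := Finset.sum_le_sum (s := Finset.univ) (fun (c : Fin d) _ =>
      show ((numOrbits (σ ∘ resA α (S'.filter fun x => c ∈ col x)) : ℤ)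
        - (isolatedVerts σ S' : ℤ)) + (if c ∈ col x then (1 : ℤ) else 0) ≤
        ((numOrbits (σ ∘ resA α (S.filter fun x => c ∈ col x)) : ℤ)
        - (isolatedVerts σ S : ℤ)) + 1 from by
      split_ifs with h
      · rw [hin c h]
        have := orb_swap_lt (σ ∘ resA α (S.filter fun y => c ∈ col y))
          (hσ.comp (resA_bij hα (hTcl c))) x (α x) (by
            intro he
            have := rel_lift (fun z => ∃ k, σ^[k] z ∈ S) (fun z => by
              apply propext
              show (∃ k, σ^[k] (σ (resA α _ z)) ∈ S) ↔ _
              rw [hits_step hσ]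
              unfold resA
              split_ifs with hz
              · have hz' := (Finset.mem_filter.1 hz).1
                exact ⟨fun _ => ⟨0, hz'⟩, fun _ => ⟨0, hS _ hz'⟩⟩
              · rfl) (oqMk_eq.1 he)
            simp only [eq_iff_iff] at this
            exact hB (this.1 hxS))
        zify at this
        linarith
      · rw [hout c h]; linarith)
    rw [Finset.sum_add_distrib, hsum1, Finset.sum_add_distrib] at this
    simp only [Finset.sum_const, Finset.card_univ, Fintype.card_fin, nsmul_eq_mul, mul_one] at this
    linarith

theorem exists_next {σ α : E → E} (hσ : Bijective σ) (hα : ∀ x, α (α x) = x)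
    (hconn : MapConnected σ α) {S : Finset E} (hne : S.Nonempty) (hS : ∀ x ∈ S, α x ∈ S)
    (hU : S ≠ Finset.univ) : ∃ x, x ∉ S ∧ ∃ k, σ^[k] x ∈ S := by
  by_contra hcon
  push Not at hcon
  have hcl : ∀ x, (∃ k, σ^[k] x ∈ S) → x ∈ S := by
    rintro x ⟨k, hk⟩
    by_contra hx
    exact hcon x hx k hk
  apply hU
  obtain ⟨a, ha⟩ := hne
  ext y
  simp only [Finset.mem_univ, iff_true]
  have key : ∀ x y, Relation.EqvGen (fun a b => σ a = b ∨ α a = b) x y → (x ∈ S ↔ y ∈ S) := by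
    intro x y h
    induction h with
    | rel a b h =>
      rcases h with rfl | rfl
      · exact ⟨fun h => hcl _ ((hits_step hσ S a).2 ⟨0, h⟩), fun h => hcl _ ⟨1, h⟩⟩
      · exact ⟨hS a, fun h => by have := hS _ h; rwa [hα] at this⟩
    | refl a => rfl
    | symm a b _ ih => exact ih.symm
    | trans a b c _ _ h1 h2 => exact h1.trans h2
  exact (key a y (hconn a y)).1 ha

theorem pot_mono {d : ℕ} {σ α : E → E} (hσ : Bijective σ) (hα : ∀ x, α (α x) = x)
    (hne : ∀ x, α x ≠ x)
    {col : E → Finset (Fin d)} (hc : ∀ x, col (α x) = col x) (hconn : MapConnected σ α)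
    (s : Finset (Fin d) → ℤ)
    (hs : ∀ C : Finset (Fin d), 2 * C.card ≤ d → s C ≤ (C.card : ℤ) - d)
    (hsize : ∀ y, 2 * (col y).card ≤ d) (n : ℕ) :
    ∀ S : Finset E, Sᶜ.card = n → S.Nonempty → (∀ x ∈ S, α x ∈ S) →
      pot σ α col s Finset.univ ≤ pot σ α col s S := by
  induction n using Nat.strong_induction_on with
  | _ n ih =>
    intro S hn hSne hS
    by_cases hU : S = Finset.univ
    · rw [hU]
    obtain ⟨x, hx, hxS⟩ := exists_next hσ hα hconn hSne hS hU
    refine le_trans ?_ (pot_step hσ hα hne hc s hs hsize hS hx hxS)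
    refine ih _ ?_ _ rfl (hSne.mono Finset.subset_union_left) ?_
    · rw [← hn]
      apply Finset.card_lt_card
      rw [Finset.compl_ssubset_compl]
      exact Finset.ssubset_iff_of_subset Finset.subset_union_left |>.2 ⟨x, by simp, hx⟩
    · intro y hy
      simp only [Finset.mem_union, Finset.mem_insert, Finset.mem_singleton] at hy ⊢
      rcases hy with h | rfl | rfl
      · exact Or.inl (hS y h)
      · exact Or.inr (Or.inr rfl)
      · exact Or.inr (Or.inl (hα _))

end

/-- Lemma `thm:Submaps`: if `s_C ≤ |C| - d` for all color sets with
`|C| ≤ d/2`, then `δ` is monotone under passing to connected submaps. -/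
theorem delta_mono_submap {D : Type*} [Fintype D] [DecidableEq D] {d : ℕ}
    (σ α : D → D) (col : D → Finset (Fin d)) (s : Finset (Fin d) → ℤ)
    (hs : ∀ C : Finset (Fin d), 2 * C.card ≤ d → s C ≤ (C.card : ℤ) - d)
    (hM : ProperMap σ α col) (hsize : ∀ y, 2 * (col y).card ≤ d)
    (S : Finset D) (hSne : S.Nonempty) (hSα : ∀ x ∈ S, α x ∈ S)
    (hsubconn : MapConnected (indSigma σ S) (indAlpha α S)) :
    deltaMap σ α col s ≤
      deltaMap (indSigma σ S) (indAlpha α S) (fun y => col y.1) s := by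
  obtain ⟨hσ, hα, hne, hc, hconn⟩ := hM
  rw [pot_sub hσ hα hc s hSα, pot_univ hσ hα hc s]
  exact pot_mono hσ hα hne hc hconn s hs hsize _ S rfl hSne hSα
end

section
/- For the quartic tensor model in rank d, there is a non-trivial large N limit if and only if the scaling coefficients are s_C = |C| - d for every admissible color set C; with this choice, δ(G) = d for all dominant graphs, and in particular all plane trees (in the intermediate field representation) satisfy δ(T) = d. -/
attribute [local instance] Classical.propDecidable

open Function

variable {D : Type*} [Fintype D] [DecidableEq D]

/-- A decorated combinatorial map in the intermediate field representation of the quartic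
model: darts `Fin n`, rotation `σ`, dart-reversal `α`, edge decorations `col`. -/
structure DecMap (d : ℕ) where
  n : ℕ
  σ : Fin n → Fin n
  α : Fin n → Fin n
  col : Fin n → Finset (Fin d)

/-- Admissible color sets: nonempty, `|C| ≤ d/2`, and `1 ∈ C` when `|C| = d/2`
(the color `1` is `(0 : Fin d)`). -/
def AdmSet (d : ℕ) (C : Finset (Fin d)) : Prop :=
  C.Nonempty ∧ 2 * C.card ≤ d ∧ (2 * C.card = d → ∃ h : 0 < d, (⟨0, h⟩ : Fin d) ∈ C)

def DecMap.Proper {d : ℕ} (M : DecMap d) : Prop := ProperMap M.σ M.α M.col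

def DecMap.Adm {d : ℕ} (M : DecMap d) : Prop := ∀ x, AdmSet d (M.col x)

noncomputable def DecMap.delta {d : ℕ} (M : DecMap d) (s : Finset (Fin d) → ℤ) : ℤ :=
  deltaMap M.σ M.α M.col s

def DecMap.bC {d : ℕ} (M : DecMap d) (C : Finset (Fin d)) : ℕ := bCnt M.col C

/-- Plane trees: connected maps with one more vertex than edges. -/
def DecMap.IsTreeMap {d : ℕ} (M : DecMap d) : Prop := 2 * numOrbits M.σ = M.n + 2

section Helpers

/-- Number of classes of the equivalence generated by `r`. -/
noncomputable def numCl {D : Type*} (r : D → D → Prop) : ℕ :=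
  Nat.card (Quotient (Relation.EqvGen.setoid r))

theorem eqvGen_mono' {D : Type*} {r r' : D → D → Prop}
    (h : ∀ a b, r a b → Relation.EqvGen r' a b) {a b : D} (hab : Relation.EqvGen r a b) :
    Relation.EqvGen r' a b := by
  induction hab with
  | rel _ _ h' => exact h _ _ h'
  | refl _ => exact .refl _
  | symm _ _ _ ih => exact .symm _ _ ih
  | trans _ _ _ _ _ i1 i2 => exact .trans _ _ _ i1 i2

theorem eqvGen_inv {D X : Type*} {r : D → D → Prop} (f : D → X)
    (h : ∀ a b, r a b → f a = f b) {a b : D} (hab : Relation.EqvGen r a b) : f a = f b := by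
  induction hab with
  | rel _ _ h' => exact h _ _ h'
  | refl _ => rfl
  | symm _ _ _ ih => exact ih.symm
  | trans _ _ _ _ _ i1 i2 => exact i1.trans i2

/-- The canonical map between quotients. -/
def clMap {D : Type*} {r r' : D → D → Prop}
    (h : ∀ a b, r a b → Relation.EqvGen r' a b) :
    Quotient (Relation.EqvGen.setoid r) → Quotient (Relation.EqvGen.setoid r') :=
  Quotient.lift (fun a => Quotient.mk _ a) (fun _ _ hab => Quotient.sound (eqvGen_mono' h hab))

theorem clMap_surj {D : Type*} {r r' : D → D → Prop}
    (h : ∀ a b, r a b → Relation.EqvGen r' a b) : Function.Surjective (clMap h) := by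
  intro q
  induction q using Quotient.inductionOn with
  | h a => exact ⟨Quotient.mk _ a, rfl⟩

theorem numCl_le {D : Type*} [Finite D] {r r' : D → D → Prop}
    (h : ∀ a b, r a b → Relation.EqvGen r' a b) : numCl r' ≤ numCl r :=
  Nat.card_le_card_of_surjective _ (clMap_surj h)

theorem numCl_lt {D : Type*} [Finite D] {r r' : D → D → Prop}
    (h : ∀ a b, r a b → Relation.EqvGen r' a b) {x y : D} (hxy : Relation.EqvGen r' x y)
    (hn : ¬ Relation.EqvGen r x y) : numCl r' < numCl r := by
  refine lt_of_le_of_ne (numCl_le h) fun heq => hn ?_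
  have hb : Function.Bijective (clMap h) :=
    (Nat.bijective_iff_surjective_and_card _).2 ⟨clMap_surj h, heq.symm⟩
  have : (Quotient.mk (Relation.EqvGen.setoid r) x) = Quotient.mk _ y :=
    hb.1 (Quotient.sound hxy)
  exact Quotient.exact this

theorem numCl_le_succ {D : Type*} [Finite D] {r r' : D → D → Prop} (x y : D)
    (h : ∀ a b, r' a b → Relation.EqvGen (fun a b => r a b ∨ (a = x ∧ b = y)) a b) :
    numCl r ≤ numCl r' + 1 := by
  classical
  let Q := Quotient (Relation.EqvGen.setoid r)
  let m : D → Q := fun a => Quotient.mk _ a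
  let f : D → Q := fun a => if m a = m y then m x else m a
  have hf : ∀ a b, r' a b → f a = f b := by
    intro a b hab
    refine eqvGen_inv f ?_ (h a b hab)
    rintro a b (hab | ⟨rfl, rfl⟩)
    · have : m a = m b := Quotient.sound (.rel _ _ hab)
      simp only [f, this]
    · by_cases hh : m a = m b <;> simp [f, hh]
  let F : Quotient (Relation.EqvGen.setoid r') → Q :=
    Quotient.lift f (fun _ _ hab => eqvGen_inv f hf hab)
  let G : Option (Quotient (Relation.EqvGen.setoid r')) → Q := fun o => o.elim (m y) F
  have hG : Function.Surjective G := by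
    intro q
    induction q using Quotient.inductionOn with
    | h a =>
      by_cases hh : m a = m y
      · exact ⟨none, hh.symm⟩
      · refine ⟨some (Quotient.mk _ a), ?_⟩
        change f a = m a
        simp [f, hh]
  have := Nat.card_le_card_of_surjective G hG
  rwa [Finite.card_option] at this

/-- `numOrbits` as a number of classes. -/
theorem numOrbits_eq {D : Type*} (f : D → D) : numOrbits f = numCl (fun x y => f x = y) := rfl

theorem orb_iter {D : Type*} (f : D → D) (a : D) (k : ℕ) :
    Relation.EqvGen (fun x y => f x = y) a (f^[k] a) := by
  induction k with
  | zero => exact .refl _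
  | succ k ih =>
    rw [Function.iterate_succ_apply']
    exact .trans _ _ _ ih (.rel _ _ rfl)

theorem exists_period {D : Type*} [Finite D] (f : D → D) (hf : Function.Injective f) (a : D) :
    ∃ k, 0 < k ∧ f^[k] a = a := by
  have := hf.mem_periodicPts a
  obtain ⟨k, hk, h⟩ := this
  exact ⟨k, hk, h⟩

section SwapLemmas
variable {D : Type*} [Finite D] {f g : D → D} {x y : D}

theorem swap_le (hx : g x = f y) (hy : g y = f x)
    (ho : ∀ a, a ≠ x → a ≠ y → g a = f a) : numOrbits f ≤ numOrbits g + 1 := by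
  refine numCl_le_succ x y ?_
  rintro a b rfl
  have hxy : Relation.EqvGen (fun a b => f a = b ∨ (a = x ∧ b = y)) x y := .rel _ _ (Or.inr ⟨rfl, rfl⟩)
  have hs : ∀ a, Relation.EqvGen (fun a b => f a = b ∨ (a = x ∧ b = y)) a (f a) :=
    fun a => .rel _ _ (Or.inl rfl)
  by_cases h1 : a = x
  · subst h1; rw [hx]; exact .trans _ _ _ hxy (hs y)
  by_cases h2 : a = y
  · subst h2; rw [hy]; exact .trans _ _ _ (.symm _ _ hxy) (hs x)
  rw [ho a h1 h2]; exact hs a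

theorem swap_lt (hf : Function.Injective f) (hx : g x = f y) (hy : g y = f x)
    (ho : ∀ a, a ≠ x → a ≠ y → g a = f a)
    (hn : ¬ Relation.EqvGen (fun a b => f a = b) x y) : numOrbits g < numOrbits f := by
  classical
  have hex := exists_period f hf y
  have hspec := Nat.find_spec hex
  have hmin : ∀ k, k < Nat.find hex → 0 < k → f^[k] y ≠ y := fun k hk h0 h =>
    Nat.find_min hex hk ⟨h0, h⟩
  have key : ∀ k, k + 1 ≤ Nat.find hex →
      Relation.EqvGen (fun a b => g a = b) x (f^[k+1] y) := by
    intro k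
    induction k with
    | zero => intro _; exact .rel _ _ hx
    | succ k ih =>
      intro hk
      refine .trans _ _ _ (ih (by omega)) (.rel _ _ ?_)
      rw [Function.iterate_succ_apply' f (k+1)]
      refine ho _ ?_ (hmin _ (by omega) (by omega))
      intro h
      apply hn
      have := orb_iter f y (k+1)
      rw [h] at this
      exact .symm _ _ this
  have hxy : Relation.EqvGen (fun a b => g a = b) x y := by
    have := key (Nat.find hex - 1) (by omega)
    rwa [Nat.sub_add_cancel hspec.1, hspec.2] at this
  refine numCl_lt ?_ hxy hn
  rintro a b rfl
  by_cases h1 : a = x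
  · subst h1; rw [← hy]; exact .trans _ _ _ hxy (.rel _ _ rfl)
  by_cases h2 : a = y
  · subst h2; rw [← hx]; exact .trans _ _ _ (.symm _ _ hxy) (.rel _ _ rfl)
  rw [← ho a h1 h2]; exact .rel _ _ rfl

end SwapLemmas

section FaceOrb
variable {D : Type*} [Fintype D] [DecidableEq D]

/-- Face permutation on all darts. -/
noncomputable def gPerm (σ α : D → D) (S : Finset D) : D → D := fun a => σ (if a ∈ S then α a else a)

theorem sigma_path (σ α : D → D) (S : Finset D) (x : D) (k : ℕ)
    (h : ∀ j < k, σ^[j] x ∉ S) :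
    Relation.EqvGen (fun a b => gPerm σ α S a = b) x (σ^[k] x) := by
  induction k with
  | zero => exact .refl _
  | succ k ih =>
    refine .trans _ _ _ (ih fun j hj => h j (by omega)) (.rel _ _ ?_)
    rw [Function.iterate_succ_apply']
    simp [gPerm, h k (by omega)]

/-- Relation quotient for the face successor. -/
abbrev QS (σ α : D → D) (S : Finset D) :=
  Quotient (Relation.EqvGen.setoid fun x y => faceSucc σ α S x = y)

/-- The rotation on isolated vertices. -/
def isoMap (σ : D → D) (S : Finset D) : {y : D // ∀ k : ℕ, σ^[k] y ∉ S} →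
    {y : D // ∀ k : ℕ, σ^[k] y ∉ S} := fun x =>
    ⟨σ x.1, fun k hk => x.2 (k + 1) (by rw [Function.iterate_succ_apply]; exact hk)⟩

abbrev QI (σ : D → D) (S : Finset D) :=
  Quotient (Relation.EqvGen.setoid fun x y => isoMap σ S x = y)

noncomputable def rho (σ α : D → D) (S : Finset D) (x : D) : QS σ α S ⊕ QI σ S :=
  if h : ∃ k : ℕ, σ^[k] x ∈ S then
    .inl (Quotient.mk _ ⟨σ^[Nat.find h] x, Nat.find_spec h⟩)
  else .inr (Quotient.mk _ ⟨x, fun k hk => h ⟨k, hk⟩⟩)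

theorem rho_inl (σ α : D → D) (S : Finset D) (x : D) (k : ℕ) (hk : σ^[k] x ∈ S)
    (hm : ∀ j < k, σ^[j] x ∉ S) : rho σ α S x = .inl (Quotient.mk _ ⟨σ^[k] x, hk⟩) := by
  have h : ∃ k : ℕ, σ^[k] x ∈ S := ⟨k, hk⟩
  have : Nat.find h = k := (Nat.find_eq_iff h).2 ⟨hk, hm⟩
  subst this
  simp [rho, h]

theorem rho_inr (σ α : D → D) (S : Finset D) (x : D) (hx : ∀ k, σ^[k] x ∉ S) :
    rho σ α S x = .inr (Quotient.mk _ ⟨x, hx⟩) := by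
  have h : ¬ ∃ k : ℕ, σ^[k] x ∈ S := by push Not; exact hx
  simp [rho, h]

theorem faceSucc_spec (σ α : D → D) (hσ : Function.Injective σ) (S : Finset D)
    (hS : ∀ x ∈ S, α x ∈ S) (x : {y : D // y ∈ S}) :
    ∃ k : ℕ, (faceSucc σ α S x).1 = σ^[k] (σ (α x.1)) ∧
      ∀ j < k, σ^[j] (σ (α x.1)) ∉ S := by
  classical
  have h : ∃ k : ℕ, 0 < k ∧ σ^[k] (α x.1) ∈ S := by
    obtain ⟨k, h0, hk⟩ := exists_period σ hσ (α x.1)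
    exact ⟨k, h0, by rw [hk]; exact hS _ x.2⟩
  have h0 := (Nat.find_spec h).1
  refine ⟨Nat.find h - 1, ?_, ?_⟩
  · rw [← Function.iterate_succ_apply, Nat.succ_eq_add_one, Nat.sub_add_cancel h0]
    simp only [faceSucc, dif_pos h]
  · intro j hj hmem
    rw [← Function.iterate_succ_apply] at hmem
    exact Nat.find_min h (m := j+1) (by omega) ⟨by omega, hmem⟩

theorem rho_g (σ α : D → D) (hσ : Function.Injective σ) (S : Finset D)
    (hS : ∀ x ∈ S, α x ∈ S) (x : D) : rho σ α S (gPerm σ α S x) = rho σ α S x := by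
  by_cases hx : x ∈ S
  · rw [rho_inl σ α S x 0 hx (by simp)]
    obtain ⟨k, h1, h2⟩ := faceSucc_spec σ α hσ S hS ⟨x, hx⟩
    have hg : gPerm σ α S x = σ (α x) := by simp [gPerm, hx]
    rw [hg]
    have hk : σ^[k] (σ (α x)) ∈ S := by
      have := (faceSucc σ α S ⟨x, hx⟩).2
      rwa [h1] at this
    rw [rho_inl σ α S _ k hk h2]
    congr 1
    apply Quotient.sound
    refine Relation.EqvGen.symm _ _ (.rel _ _ ?_)
    exact Subtype.ext h1
  · have hg : gPerm σ α S x = σ x := by simp [gPerm, hx]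
    rw [hg]
    by_cases h : ∃ k : ℕ, σ^[k] x ∈ S
    · classical
      have hs := Nat.find_spec h
      have hm : ∀ j < Nat.find h, σ^[j] x ∉ S := fun j hj => Nat.find_min h hj
      generalize Nat.find h = k at hs hm
      rw [rho_inl σ α S x k hs hm]
      cases k with
      | zero => exact absurd hs hx
      | succ k =>
        rw [rho_inl σ α S (σ x) k hs]
        · rfl
        · intro j hj
          exact hm (j+1) (by omega)
    · push Not at h
      rw [rho_inr σ α S x h, rho_inr σ α S (σ x) (fun k => h (k+1))]
      congr 1
      apply Quotient.sound
      exact Relation.EqvGen.symm _ _ (.rel _ _ rfl)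

theorem face_count (σ α : D → D) (hσ : Function.Injective σ) (S : Finset D)
    (hS : ∀ x ∈ S, α x ∈ S) :
    numOrbits (faceSucc σ α S) + isolatedVerts σ S = numOrbits (gPerm σ α S) := by
  let QD := Quotient (Relation.EqvGen.setoid fun x y => gPerm σ α S x = y)
  let R : QD → QS σ α S ⊕ QI σ S := Quotient.lift (rho σ α S) (fun a b hab =>
    eqvGen_inv (rho σ α S) (by rintro a b rfl; exact (rho_g σ α hσ S hS a).symm) hab)
  have hb : Function.Bijective R := by
    constructor
    · let B : QS σ α S ⊕ QI σ S → QD := Sum.elim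
        (Quotient.lift (fun a => Quotient.mk _ a.1) (by
          intro a b hab
          refine eqvGen_inv (fun a : {y : D // y ∈ S} =>
            (Quotient.mk _ a.1 : QD)) ?_ hab
          rintro a b rfl
          apply Quotient.sound
          obtain ⟨k, h1, h2⟩ := faceSucc_spec σ α hσ S hS a
          rw [h1]
          refine Relation.EqvGen.trans _ (σ (α a.1)) _ (.rel _ _ ?_) (sigma_path σ α S _ k h2)
          simp [gPerm, a.2]))
        (Quotient.lift (fun a => Quotient.mk _ a.1) (by
          intro a b hab
          refine eqvGen_inv (fun a : {y : D // ∀ k : ℕ, σ^[k] y ∉ S} =>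
            (Quotient.mk _ a.1 : QD)) ?_ hab
          rintro a b rfl
          apply Quotient.sound
          refine Relation.EqvGen.rel _ _ ?_
          have := a.2 0
          simp only [Function.iterate_zero, id] at this
          simp [gPerm, isoMap, this]))
      have hBR : ∀ q, B (R q) = q := by
        intro q
        induction q using Quotient.inductionOn with
        | h a =>
          change B (rho σ α S a) = _
          by_cases h : ∃ k : ℕ, σ^[k] a ∈ S
          · classical
            have hs := Nat.find_spec h
            have hm : ∀ j < Nat.find h, σ^[j] a ∉ S := fun j hj => Nat.find_min h hj
            generalize Nat.find h = k at hs hm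
            rw [rho_inl σ α S a k hs hm]
            apply Quotient.sound
            exact Relation.EqvGen.symm _ _ (sigma_path σ α S a k hm)
          · push Not at h
            rw [rho_inr σ α S a h]
            rfl
      exact Function.LeftInverse.injective hBR
    · rintro (q | q)
      · induction q using Quotient.inductionOn with
        | h a => exact ⟨Quotient.mk _ a.1, rho_inl σ α S a.1 0 a.2 (by simp)⟩
      · induction q using Quotient.inductionOn with
        | h a => exact ⟨Quotient.mk _ a.1, rho_inr σ α S a.1 a.2⟩
  have h1 : Nat.card QD = Nat.card (QS σ α S ⊕ QI σ S) := Nat.card_eq_of_bijective R hb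
  rw [Nat.card_sum] at h1
  exact h1.symm

end FaceOrb

section Main
variable {D : Type*} [Fintype D] [DecidableEq D]

/-- Connectivity relation using only the edges in `S`. -/
def kRel (σ α : D → D) (S : Finset D) : D → D → Prop := fun a b => σ a = b ∨ (a ∈ S ∧ α a = b)

theorem gPerm_inj {σ α : D → D} (hσ : Function.Injective σ) (hα : ∀ x, α (α x) = x)
    (S : Finset D) (hS : ∀ x ∈ S, α x ∈ S) : Function.Injective (gPerm σ α S) := by
  intro a b hab
  have h := hσ hab
  by_cases ha : a ∈ S <;> by_cases hb : b ∈ S <;> simp only [ha, hb, if_true, if_false] at h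
  · rw [← hα a, h, hα]
  · exact absurd (h ▸ hS a ha) hb
  · exact absurd (h ▸ hS b hb) ha
  · exact h

theorem gPerm_le_kRel (σ α : D → D) (S U : Finset D) (hU : U ⊆ S) (a b : D)
    (h : gPerm σ α U a = b) : Relation.EqvGen (kRel σ α S) a b := by
  subst h
  by_cases ha : a ∈ U
  · refine .trans _ (α a) _ (.rel _ _ (Or.inr ⟨hU ha, rfl⟩)) (.rel _ _ (Or.inl ?_))
    simp [gPerm, ha]
  · exact .rel _ _ (Or.inl (by simp [gPerm, ha]))

theorem main_ind {d : ℕ} {σ α : D → D} {col : D → Finset (Fin d)}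
    (hσ : Function.Injective σ) (hα : ∀ x, α (α x) = x) (hαn : ∀ x, α x ≠ x)
    (hcol : ∀ x, col (α x) = col x) (hadm : ∀ x, 2 * (col x).card ≤ d) (n : ℕ) :
    ∀ S : Finset D, S.card = n → (∀ x ∈ S, α x ∈ S) →
      (2 * ∑ c : Fin d, (numOrbits (gPerm σ α (S ∩ colorDarts col c)) : ℤ)
        + ∑ x ∈ S, (((col x).card : ℤ) - d) ≤ 2 * d * (numCl (kRel σ α S) : ℤ)) ∧
      2 * numOrbits σ ≤ 2 * numCl (kRel σ α S) + S.card ∧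
      (2 * numOrbits σ = 2 * numCl (kRel σ α S) + S.card →
        2 * ∑ c : Fin d, (numOrbits (gPerm σ α (S ∩ colorDarts col c)) : ℤ)
        + ∑ x ∈ S, (((col x).card : ℤ) - d) = 2 * d * (numCl (kRel σ α S) : ℤ)) := by
  induction n using Nat.strong_induction_on with
  | _ n ih =>
  intro S hSn hS
  rcases S.eq_empty_or_nonempty with rfl | ⟨x, hx⟩
  · have h1 : ∀ c : Fin d, gPerm σ α (∅ ∩ colorDarts col c) = σ := by
      intro c; funext a; simp [gPerm]
    have h2 : numCl (kRel σ α ∅) = numOrbits σ := by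
      rw [numOrbits_eq]; congr 1; funext a b; simp [kRel]
    simp only [h1, h2, Finset.sum_empty, Finset.card_empty, Finset.sum_const, Finset.card_univ,
      Fintype.card_fin, nsmul_eq_mul]
    refine ⟨by linarith, by omega, fun _ => by ring⟩
  have hax : α x ∈ S := hS x hx
  let T := (S.erase x).erase (α x)
  have hax' : α x ∈ S.erase x := Finset.mem_erase.2 ⟨hαn x, hax⟩
  have hTc : T.card + 2 = S.card := by
    have h1 := Finset.card_erase_add_one hx
    have h2 := Finset.card_erase_add_one hax'
    change ((S.erase x).erase (α x)).card + 2 = _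
    omega
  have hmT : ∀ a, a ∈ T ↔ a ≠ α x ∧ a ≠ x ∧ a ∈ S := by intro a; simp [T]
  have hT : ∀ a ∈ T, α a ∈ T := by
    intro a ha
    rw [hmT] at ha ⊢
    refine ⟨fun h => ha.2.1 ?_, fun h => ha.1 ?_, hS a ha.2.2⟩
    · rw [← hα a, h, hα]
    · rw [← hα a, h]
  have hsum : ∑ a ∈ S, (((col a).card : ℤ) - d)
      = ∑ a ∈ T, (((col a).card : ℤ) - d) + 2 * (((col x).card : ℤ) - d) := by
    rw [← Finset.add_sum_erase _ _ hx, ← Finset.add_sum_erase _ _ hax', hcol]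
    ring
  have hind : ∑ c : Fin d, (if c ∈ col x then (1:ℤ) else 0) = (col x).card := by
    simp
  obtain ⟨i1, i2, i3⟩ := ih T.card (by omega) T rfl hT
  have hcd : ∀ c a, a ∈ colorDarts col c ↔ c ∈ col a := by intro c a; simp [colorDarts]
  -- swap relations
  have hnot : ∀ c, c ∉ col x →
      gPerm σ α (S ∩ colorDarts col c) = gPerm σ α (T ∩ colorDarts col c) := by
    intro c hc
    have : S ∩ colorDarts col c = T ∩ colorDarts col c := by
      ext a
      simp only [Finset.mem_inter, hcd, hmT]
      constructor
      · rintro ⟨h1, h2⟩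
        refine ⟨⟨?_, ?_, h1⟩, h2⟩
        · rintro rfl; rw [hcol] at h2; exact hc h2
        · rintro rfl; exact hc h2
      · rintro ⟨⟨_, _, h1⟩, h2⟩; exact ⟨h1, h2⟩
    rw [this]
  have hsx : ∀ c, c ∈ col x → gPerm σ α (S ∩ colorDarts col c) x
      = gPerm σ α (T ∩ colorDarts col c) (α x) := by
    intro c hc; simp [gPerm, hcd, hmT, hx, hc]
  have hsy : ∀ c, c ∈ col x → gPerm σ α (S ∩ colorDarts col c) (α x)
      = gPerm σ α (T ∩ colorDarts col c) x := by
    intro c hc; simp [gPerm, hcd, hmT, hax, hc, hcol, hα]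
  have hso : ∀ c a, a ≠ x → a ≠ α x → gPerm σ α (S ∩ colorDarts col c) a
      = gPerm σ α (T ∩ colorDarts col c) a := by
    intro c a h1 h2; simp [gPerm, hcd, hmT, h1, h2]
  have hTS : ∀ a b, kRel σ α T a b → Relation.EqvGen (kRel σ α S) a b := by
    rintro a b (h | ⟨h1, h2⟩)
    · exact .rel _ _ (Or.inl h)
    · exact .rel _ _ (Or.inr ⟨((hmT a).1 h1).2.2, h2⟩)
  have hST : ∀ a b, kRel σ α S a b →
      Relation.EqvGen (fun a b => kRel σ α T a b ∨ (a = x ∧ b = α x)) a b := by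
    rintro a b (h | ⟨h1, h2⟩)
    · exact .rel _ _ (Or.inl (Or.inl h))
    · by_cases ha : a = x
      · subst ha; exact .rel _ _ (Or.inr ⟨rfl, h2.symm⟩)
      by_cases hb : a = α x
      · subst hb
        rw [hα] at h2; subst h2
        exact .symm _ _ (.rel _ _ (Or.inr ⟨rfl, rfl⟩))
      · exact .rel _ _ (Or.inl (Or.inr ⟨(hmT a).2 ⟨hb, ha, h1⟩, h2⟩))
  by_cases hc : Relation.EqvGen (kRel σ α T) x (α x)
  · have hK : numCl (kRel σ α T) ≤ numCl (kRel σ α S) := by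
      refine numCl_le fun a b hab => eqvGen_mono' ?_ (hST a b hab)
      rintro a b (h | ⟨rfl, rfl⟩)
      · exact .rel _ _ h
      · exact hc
    have hF : ∀ c : Fin d, (numOrbits (gPerm σ α (S ∩ colorDarts col c)) : ℤ) ≤
        numOrbits (gPerm σ α (T ∩ colorDarts col c)) + (if c ∈ col x then 1 else 0) := by
      intro c
      by_cases h : c ∈ col x
      · rw [if_pos h]
        exact_mod_cast swap_le (x := x) (y := α x) (hsy c h).symm (hsx c h).symm
          (fun a h1 h2 => (hso c a h1 h2).symm)
      · simp [h, hnot c h]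
    have hFs := Finset.sum_le_sum fun c (_ : c ∈ Finset.univ) => hF c
    rw [Finset.sum_add_distrib, hind] at hFs
    have hA : (2 * (col x).card : ℤ) ≤ d := by exact_mod_cast hadm x
    have hK' : (2 * d * (numCl (kRel σ α T) : ℤ)) ≤ 2 * d * (numCl (kRel σ α S) : ℤ) := by
      gcongr
    refine ⟨by rw [hsum]; linarith, by omega, fun h => by omega⟩
  · have hK1 : numCl (kRel σ α S) < numCl (kRel σ α T) :=
      numCl_lt hTS (.rel _ _ (Or.inr ⟨hx, rfl⟩)) hc
    have hK2 : numCl (kRel σ α T) ≤ numCl (kRel σ α S) + 1 := numCl_le_succ x (α x) hST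
    have hK : numCl (kRel σ α T) = numCl (kRel σ α S) + 1 := by omega
    have hF : ∀ c : Fin d, (numOrbits (gPerm σ α (T ∩ colorDarts col c)) : ℤ) =
        numOrbits (gPerm σ α (S ∩ colorDarts col c)) + (if c ∈ col x then 1 else 0) := by
      intro c
      by_cases h : c ∈ col x
      · rw [if_pos h]
        have h1 := swap_le (x := x) (y := α x) (hsx c h) (hsy c h) (hso c)
        have h2 := swap_lt (x := x) (y := α x) (gPerm_inj hσ hα (T ∩ colorDarts col c) (by
          intro a ha
          simp only [Finset.mem_inter, hcd] at ha ⊢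
          exact ⟨hT a ha.1, by rw [hcol]; exact ha.2⟩)) (hsx c h) (hsy c h) (hso c)
          (fun hh => hc (eqvGen_mono' (gPerm_le_kRel σ α T _ Finset.inter_subset_left) hh))
        exact_mod_cast (by omega : numOrbits (gPerm σ α (T ∩ colorDarts col c)) =
          numOrbits (gPerm σ α (S ∩ colorDarts col c)) + 1)
      · simp [h, hnot c h]
    have hFs := Finset.sum_congr rfl fun c (_ : c ∈ Finset.univ) => hF c
    rw [Finset.sum_add_distrib, hind] at hFs
    have hK' : (2 * d * (numCl (kRel σ α T) : ℤ)) = 2 * d * (numCl (kRel σ α S) : ℤ) + 2 * d := by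
      rw [hK]; push_cast; ring
    refine ⟨by rw [hsum]; linarith, by omega, fun h => ?_⟩
    have := i3 (by omega)
    rw [hsum]; linarith

theorem two_bCnt {d : ℕ} {α : D → D} {col : D → Finset (Fin d)}
    (hα : ∀ x, α (α x) = x) (hαn : ∀ x, α x ≠ x) (hcol : ∀ x, col (α x) = col x)
    (C : Finset (Fin d)) : 2 * bCnt col C = (Finset.univ.filter fun x => col x = C).card := by
  have h : Even (Finset.univ.filter fun x => col x = C).card := by
    have h0 : ∑ x ∈ (Finset.univ.filter fun x => col x = C), (1 : ZMod 2) = 0 := by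
      refine Finset.sum_involution (fun a _ => α a) ?_ ?_ ?_ ?_
      · intros; decide
      · intro a _ _; exact hαn a
      · intro a ha; simp only [Finset.mem_filter, Finset.mem_univ, true_and] at ha ⊢
        rw [hcol]; exact ha
      · intro a _; exact hα a
    rw [Finset.sum_const, nsmul_eq_mul, mul_one] at h0
    exact (ZMod.natCast_eq_zero_iff_even).1 h0
  have := Nat.two_mul_div_two_of_even h
  unfold bCnt
  convert this using 2

theorem two_sum_b {d : ℕ} {α : D → D} {col : D → Finset (Fin d)}
    (hα : ∀ x, α (α x) = x) (hαn : ∀ x, α x ≠ x) (hcol : ∀ x, col (α x) = col x)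
    (s : Finset (Fin d) → ℤ) :
    2 * ∑ C : Finset (Fin d), s C * (bCnt col C : ℤ) = ∑ x, s (col x) := by
  rw [← Finset.sum_fiberwise Finset.univ col (fun x => s (col x)), Finset.mul_sum]
  refine Finset.sum_congr rfl fun C _ => ?_
  rw [Finset.sum_congr rfl (g := fun _ => s C) (by
    intro x hx; rw [(Finset.mem_filter.1 hx).2]), Finset.sum_const, nsmul_eq_mul]
  have := two_bCnt hα hαn hcol C
  have h2 : (2 * (bCnt col C : ℤ)) = ((Finset.univ.filter fun x => col x = C).card : ℤ) := by
    exact_mod_cast this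
  have h3 : 2 * (s C * (bCnt col C : ℤ)) = (2 * (bCnt col C : ℤ)) * s C := by ring
  rw [h3, h2]

theorem delta_main {d : ℕ} {σ α : D → D} {col : D → Finset (Fin d)}
    (hP : ProperMap σ α col) (hadm : ∀ x, AdmSet d (col x)) :
    deltaMap σ α col (fun C => (C.card : ℤ) - d) ≤ d ∧
    2 * numOrbits σ ≤ Fintype.card D + 2 ∧
    (2 * numOrbits σ = Fintype.card D + 2 →
      deltaMap σ α col (fun C => (C.card : ℤ) - d) = d) := by
  obtain ⟨hσ, hα, hαn, hcol, hconn⟩ := hP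
  obtain ⟨h1, h2, h3⟩ := main_ind hσ.1 hα hαn hcol (fun x => (hadm x).2.1) _ Finset.univ rfl
    (by simp)
  have hK : numCl (kRel σ α Finset.univ) ≤ 1 := by
    have : Subsingleton (Quotient (Relation.EqvGen.setoid (kRel σ α Finset.univ))) := by
      constructor
      intro a b
      induction a using Quotient.inductionOn with
      | h a =>
      induction b using Quotient.inductionOn with
      | h b =>
      apply Quotient.sound
      refine eqvGen_mono' ?_ (hconn a b)
      rintro a b (h | h)
      · exact .rel _ _ (Or.inl h)
      · exact .rel _ _ (Or.inr ⟨Finset.mem_univ _, h⟩)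
    exact Finite.card_le_one_iff_subsingleton.2 this
  have hF : ∀ c : Fin d, Fc σ α col c = numOrbits (gPerm σ α (Finset.univ ∩ colorDarts col c)) := by
    intro c
    rw [Finset.univ_inter]
    refine face_count σ α hσ.1 _ ?_
    intro x hx
    simp only [colorDarts, Finset.mem_filter, Finset.mem_univ, true_and] at hx ⊢
    rw [hcol]; exact hx
  have hb := two_sum_b hα hαn hcol (fun C => (C.card : ℤ) - d)
  have hD : 2 * deltaMap σ α col (fun C => (C.card : ℤ) - d) =
      2 * ∑ c : Fin d, (numOrbits (gPerm σ α (Finset.univ ∩ colorDarts col c)) : ℤ)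
        + ∑ x, (((col x).card : ℤ) - d) := by
    rw [← hb, deltaMap, mul_add]
    simp only [hF]
  rw [← hD] at h1 h3
  rw [Finset.card_univ] at h2 h3
  have hK' : (2 * d * (numCl (kRel σ α Finset.univ) : ℤ)) ≤ 2 * d * 1 := by
    gcongr; exact_mod_cast hK
  refine ⟨by linarith, by omega, fun h => ?_⟩
  have hK1 : numCl (kRel σ α Finset.univ) = 1 := by omega
  have := h3 (by omega)
  rw [hK1] at this
  push_cast at this
  linarith

end Main

theorem delta_split {d : ℕ} (M : DecMap d) (s : Finset (Fin d) → ℤ) :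
    M.delta s = M.delta (fun C => (C.card : ℤ) - d)
      + ∑ C : Finset (Fin d), (s C - ((C.card : ℤ) - d)) * (M.bC C : ℤ) := by
  simp only [DecMap.delta, deltaMap, DecMap.bC, add_assoc, ← Finset.sum_add_distrib]
  congr 1
  refine Finset.sum_congr rfl fun C _ => by ring

theorem bC_zero {d : ℕ} (M : DecMap d) (hM : M.Adm) (C : Finset (Fin d)) (hC : ¬ AdmSet d C) :
    M.bC C = 0 := by
  have : (Finset.univ.filter fun x => M.col x = C) = ∅ := by
    ext x
    simp only [Finset.mem_filter, Finset.mem_univ, true_and, Finset.notMem_empty, iff_false]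
    rintro rfl
    exact hC (hM x)
  unfold DecMap.bC bCnt
  have h2 : (Finset.univ.filter fun x => M.col x = C).card = 0 := by rw [this]; rfl
  rw [h2]

/-- Star tree with `N + 1` edges. -/
def starMap (d : ℕ) (C : Finset (Fin d)) (N : ℕ) : DecMap d where
  n := 2 * (N + 1)
  σ := fun i => if h : i.1 < N then ⟨i.1 + 1, by omega⟩ else if i.1 = N then ⟨0, by omega⟩ else i
  α := fun i => if h : i.1 < N + 1 then ⟨i.1 + (N + 1), by omega⟩ else ⟨i.1 - (N + 1), by omega⟩
  col := fun _ => C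

theorem star_proper (d : ℕ) (C : Finset (Fin d)) (N : ℕ) : (starMap d C N).Proper := by
  refine ⟨Finite.injective_iff_bijective.1 ?_, ?_, ?_, fun _ => rfl, ?_⟩
  · intro a b h
    simp only [starMap] at h a b
    split_ifs at h <;> simp only [Fin.ext_iff] at h ⊢ <;> omega
  · intro a
    have ha : a.1 < 2 * (N + 1) := a.2
    apply Fin.ext
    by_cases h : a.1 < N + 1
    · have h2 : ¬ (a.1 + (N + 1) < N + 1) := by omega
      simp only [starMap, h, dif_pos, h2, dif_neg, not_false_eq_true]
      omega
    · have h2 : a.1 - (N + 1) < N + 1 := by omega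
      simp only [starMap, h, dif_pos, h2, dif_neg, not_false_eq_true]
      omega
  · intro a h
    simp only [starMap] at a h
    split_ifs at h <;> simp only [Fin.ext_iff] at h <;> omega
  · have key : ∀ k (hk : k < N + 1), Relation.EqvGen
        (fun a b => (starMap d C N).σ a = b ∨ (starMap d C N).α a = b)
        (⟨0, by simp [starMap]⟩ : Fin (starMap d C N).n)
        ⟨k, by simp only [starMap]; omega⟩ := by
      intro k
      induction k with
      | zero => intro _; exact .refl _
      | succ k ih =>
        intro hk
        refine .trans _ _ _ (ih (by omega)) (.rel _ _ (Or.inl ?_))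
        have : k < N := by omega
        simp [starMap, this]
    have key2 : ∀ a, Relation.EqvGen
        (fun a b => (starMap d C N).σ a = b ∨ (starMap d C N).α a = b)
        (⟨0, by simp [starMap]⟩ : Fin (starMap d C N).n) a := by
      intro a
      by_cases h : a.1 < N + 1
      · exact key a.1 h
      · have ha : a.1 < 2 * (N + 1) := a.2
        refine .trans _ _ _ (key (a.1 - (N+1)) (by omega)) (.rel _ _ (Or.inr ?_))
        have h' : a.1 - (N + 1) < N + 1 := by omega
        apply Fin.ext
        simp only [starMap, h', dif_pos]
        omega
    intro a b
    exact .trans _ _ _ (.symm _ _ (key2 a)) (key2 b)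

theorem star_bC (d : ℕ) (C : Finset (Fin d)) (N : ℕ) : (starMap d C N).bC C = N + 1 := by
  have h : (Finset.univ : Finset (Fin (starMap d C N).n)).card = 2 * (N + 1) := by
    rw [Finset.card_univ, Fintype.card_fin]; rfl
  have h2 : (Finset.univ.filter fun x => (starMap d C N).col x = C) = Finset.univ := by
    ext x; simp [starMap]
  unfold DecMap.bC bCnt
  rw [h2, h]
  omega

theorem star_bC_ne (d : ℕ) (C C' : Finset (Fin d)) (N : ℕ) (h : C' ≠ C) :
    (starMap d C N).bC C' = 0 := by
  simp [DecMap.bC, bCnt, starMap, Ne.symm h]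

theorem star_tree (d : ℕ) (C : Finset (Fin d)) (N : ℕ) (hC : AdmSet d C) :
    (starMap d C N).IsTreeMap := by
  have h1 := (delta_main (star_proper d C N) (fun _ => hC)).2.1
  rw [Fintype.card_fin] at h1
  have hn : (starMap d C N).n = 2 * (N + 1) := rfl
  let f : Fin (starMap d C N).n → Fin (N + 2) := fun i =>
    if h : i.1 < N + 1 then ⟨0, by omega⟩ else ⟨i.1 - N, by have := i.2; omega⟩
  have hf : ∀ a b, (starMap d C N).σ a = b → f a = f b := by
    rintro a b rfl
    apply Fin.ext
    have := a.2
    simp only [f, starMap]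
    split_ifs <;> simp_all <;> omega
  let F : Quotient (Relation.EqvGen.setoid fun a b => (starMap d C N).σ a = b) → Fin (N + 2) :=
    Quotient.lift f (fun _ _ hab => eqvGen_inv f hf hab)
  have hF : Function.Surjective F := by
    intro i
    by_cases hi : i.1 = 0
    · refine ⟨Quotient.mk _ ⟨0, by omega⟩, ?_⟩
      apply Fin.ext
      change (f ⟨0, _⟩).1 = _
      simp [f, hi]
    · refine ⟨Quotient.mk _ ⟨i.1 + N, by have := i.2; omega⟩, ?_⟩
      apply Fin.ext
      change (f ⟨i.1 + N, _⟩).1 = _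
      have : ¬ (i.1 + N < N + 1) := by omega
      simp only [f, this, dif_neg, not_false_eq_true]
      omega
  have h2 := Nat.card_le_card_of_surjective F hF
  rw [Nat.card_eq_fintype_card, Fintype.card_fin] at h2
  change N + 2 ≤ numOrbits (starMap d C N).σ at h2
  unfold DecMap.IsTreeMap
  omega

theorem star_delta (d : ℕ) (C : Finset (Fin d)) (N : ℕ) (hC : AdmSet d C)
    (s : Finset (Fin d) → ℤ) :
    (starMap d C N).delta s = d + (s C - ((C.card : ℤ) - d)) * (N + 1) := by
  rw [delta_split]
  have h1 : (starMap d C N).delta (fun C => (C.card : ℤ) - d) = d := by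
    refine (delta_main (star_proper d C N) (fun _ => hC)).2.2 ?_
    rw [Fintype.card_fin]
    exact star_tree d C N hC
  rw [h1, Finset.sum_eq_single C]
  · rw [star_bC]; push_cast; rfl
  · intro C' _ h; rw [star_bC_ne d C C' N h]; simp
  · simp

theorem delta_std {d : ℕ} (s : Finset (Fin d) → ℤ)
    (hs : ∀ C : Finset (Fin d), AdmSet d C → s C = (C.card : ℤ) - d) (M : DecMap d)
    (hM : M.Adm) : M.delta s = M.delta (fun C => (C.card : ℤ) - d) := by
  rw [delta_split, Finset.sum_eq_zero, add_zero]
  intro C _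
  by_cases hC : AdmSet d C
  · rw [hs C hC]; ring
  · rw [bC_zero M hM C hC]; simp

end Helpers

/-- Theorem `thm:Quartic`: the quartic model has a non-trivial large `N`
limit iff `s_C = |C| - d` for every admissible color set; with this choice `δ = d` on
dominant graphs, and all plane trees satisfy `δ(T) = d`. -/
theorem quartic_large_N (d : ℕ) (hd : 2 < d) (s : Finset (Fin d) → ℤ) :
    ((∃ m : ℤ,
        (∀ M : DecMap d, M.Proper → M.Adm → M.delta s ≤ m) ∧
        (∀ C : Finset (Fin d), AdmSet d C → ∀ N : ℕ,
          ∃ M : DecMap d, M.Proper ∧ M.Adm ∧ M.delta s = m ∧ N ≤ M.bC C)) ↔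
      (∀ C : Finset (Fin d), AdmSet d C → s C = (C.card : ℤ) - d)) ∧
    ((∀ C : Finset (Fin d), AdmSet d C → s C = (C.card : ℤ) - d) →
      (∀ M : DecMap d, M.Proper → M.Adm → M.delta s ≤ d) ∧
      (∀ M : DecMap d, M.Proper → M.Adm →
        (∀ M' : DecMap d, M'.Proper → M'.Adm → M'.delta s ≤ M.delta s) → M.delta s = d) ∧
      (∀ M : DecMap d, M.Proper → M.Adm → M.IsTreeMap → M.delta s = d)) := by
  have part2 : (∀ C : Finset (Fin d), AdmSet d C → s C = (C.card : ℤ) - d) →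
      (∀ M : DecMap d, M.Proper → M.Adm → M.delta s ≤ d) := by
    intro hs M hP hA
    rw [delta_std s hs M hA]
    exact (delta_main hP hA).1
  refine ⟨⟨?_, ?_⟩, fun hs => ⟨part2 hs, ?_, ?_⟩⟩
  · rintro ⟨m, hb, hu⟩
    have hle : ∀ C : Finset (Fin d), AdmSet d C → s C ≤ (C.card : ℤ) - d := by
      intro C hC
      by_contra hlt
      push Not at hlt
      have h := hb (starMap d C m.natAbs) (star_proper d C _) (fun _ => hC)
      rw [star_delta d C _ hC] at h
      have h1 : (1 : ℤ) ≤ s C - ((C.card : ℤ) - d) := by omega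
      have h2 : m ≤ (m.natAbs : ℤ) := Int.le_natAbs
      nlinarith
    intro C hC
    refine le_antisymm (hle C hC) ?_
    by_contra hlt
    push Not at hlt
    obtain ⟨M, hP, hA, hm, hN⟩ := hu C hC ((d : ℤ) - m + 1).natAbs
    have h1 : M.delta (fun C => (C.card : ℤ) - d) ≤ d := (delta_main hP hA).1
    rw [delta_split] at hm
    have hnp : ∀ C' ∈ (Finset.univ : Finset (Finset (Fin d))),
        0 ≤ - ((s C' - ((C'.card : ℤ) - d)) * (M.bC C' : ℤ)) := by
      intro C' _
      by_cases hC' : AdmSet d C'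
      · have := hle C' hC'
        have h0 : (0 : ℤ) ≤ M.bC C' := Int.natCast_nonneg _
        nlinarith
      · rw [bC_zero M hA C' hC']; simp
    have h2 := Finset.single_le_sum hnp (Finset.mem_univ C)
    rw [Finset.sum_neg_distrib] at h2
    have h3 : ((d : ℤ) - m + 1) ≤ M.bC C := by omega
    have h4 : (0 : ℤ) ≤ M.bC C := Int.natCast_nonneg _
    nlinarith
  · intro hs
    refine ⟨d, part2 hs, fun C hC N => ⟨starMap d C N, star_proper d C N, fun _ => hC, ?_, ?_⟩⟩
    · rw [star_delta d C N hC, hs C hC]; ring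
    · rw [star_bC]; omega
  · intro M hP hA hmax
    refine le_antisymm (part2 hs M hP hA) ?_
    have hC : AdmSet d {(⟨0, by omega⟩ : Fin d)} := by
      refine ⟨Finset.singleton_nonempty _, ?_, ?_⟩
      · rw [Finset.card_singleton]; omega
      · rw [Finset.card_singleton]; omega
    have h := hmax (starMap d _ 0) (star_proper d _ 0) (fun _ => hC)
    rw [star_delta d _ 0 hC, hs _ hC] at h
    linarith
  · intro M hP hA hT
    rw [delta_std s hs M hA]
    refine (delta_main hP hA).2.2 ?_
    rw [Fintype.card_fin]
    exact hT
end

section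
/- Fix a plane tree T with half-edges h, and for each half-edge let T_h be the subtree on the far side of the edge containing h together with that edge, with E(T_h) its number of edges. Given color sets C_e with |C_e| < d/2 and s = −d(V−2)/2 + Σ_{e⊂T} |C_e| where E(T) = (V−2)/2, the coefficients η_h = (d + 2s/(V−2)) E(T_h) − Σ_{e⊂T_h} |C_e| are the unique solution of the system: (i) for every edge e = {h, h'}, η_h + η_{h'} = d + 2s/(V−2) − |C_e|; (ii) for every vertex v, Σ_{h_v incident to v} η_{h_v} = 0. -/
attribute [local instance] Classical.propDecidable

/-- `E(T_h)`: number of edges of the subtree `T_h` opposite to the half-edge (dart) `h`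
together with the edge containing `h`.  In a tree this equals the number of vertices of the
component of the far endpoint of `h` after deleting the edge of `h`. -/
noncomputable def subtreeEdges {V : Type*} [Fintype V] (T : SimpleGraph V)
    (h : T.Dart) : ℕ :=
  Nat.card {u : V // (T.deleteEdges {h.edge}).Reachable h.toProd.2 u}

/-- `Σ_{e ⊂ T_h} |C_e|`: sum of the color set sizes over the edges of `T_h` (the edge of
`h` together with the edges of the component of the far endpoint of `h`). -/
noncomputable def subtreeColorSum {V : Type*} [Fintype V] {d : ℕ} (T : SimpleGraph V)
    (cE : Sym2 V → Finset (Fin d)) (h : T.Dart) : ℚ :=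
  ((cE h.edge).card : ℚ) +
    ∑ e ∈ T.edgeFinset.filter
        (fun e => e ≠ h.edge ∧ ∀ u ∈ e, (T.deleteEdges {h.edge}).Reachable h.toProd.2 u),
      ((cE e).card : ℚ)

/-- `u` lies on the far side of the dart `h`. -/
def farSide {V : Type*} (T : SimpleGraph V) (h : T.Dart) (u : V) : Prop :=
  (T.deleteEdges {h.edge}).Reachable h.toProd.2 u

theorem farSide_snd {V : Type*} (T : SimpleGraph V) (h : T.Dart) : farSide T h h.toProd.2 :=
  SimpleGraph.Reachable.refl _

theorem not_farSide_fst {V : Type*} {T : SimpleGraph V} (hT : T.IsTree) (h : T.Dart) :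
    ¬ farSide T h h.toProd.1 := by
  intro hr
  have hb := SimpleGraph.isAcyclic_iff_forall_adj_isBridge.1 hT.isAcyclic h.adj
  rw [SimpleGraph.isBridge_iff] at hb
  exact hb hr.symm

theorem farSide_symm_iff {V : Type*} {T : SimpleGraph V} (hT : T.IsTree) (h : T.Dart) (u : V) :
    farSide T h.symm u ↔ ¬ farSide T h u := by
  have he : h.symm.edge = h.edge := SimpleGraph.Dart.edge_symm h
  constructor
  · intro h1 h2
    apply not_farSide_fst hT h
    unfold farSide at *
    rw [he] at h1
    exact h2.trans h1.symm
  · intro h2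
    have key : ∀ (a b : V) (p : T.Walk a b), (farSide T h a ∨ farSide T h.symm a) →
        (farSide T h b ∨ farSide T h.symm b) := by
      intro a b p
      induction p with
      | nil => exact id
      | @cons x y z hxy p ih =>
        intro hx
        apply ih
        by_cases hh : s(x, y) = h.edge
        · have hy : y ∈ h.edge := hh ▸ Sym2.mem_mk_right x y
          have : y = h.toProd.1 ∨ y = h.toProd.2 := by
            simpa [SimpleGraph.Dart.edge] using hy
          rcases this with rfl | rfl
          · right; exact farSide_snd T h.symm
          · left; exact farSide_snd T h
        · have hadj : (T.deleteEdges {h.edge}).Adj x y := by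
            simp [SimpleGraph.deleteEdges_adj, hxy, hh]
          rcases hx with hx | hx
          · left; exact SimpleGraph.Reachable.trans hx hadj.reachable
          · right
            unfold farSide at *
            rw [he] at *
            exact SimpleGraph.Reachable.trans hx hadj.reachable
    obtain ⟨p⟩ := hT.connected.preconnected h.toProd.2 u
    exact (key _ _ p (Or.inl (farSide_snd T h))).resolve_left h2

theorem farSide_path {V : Type*} {T : SimpleGraph V} (hT : T.IsTree) (h : T.Dart) (u : V)
    (hu : farSide T h u) : ∃ p : T.Walk h.toProd.1 u, p.IsPath ∧ p.snd = h.toProd.2 := by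
  obtain ⟨p, hp⟩ := SimpleGraph.Reachable.exists_isPath hu
  have hv : h.toProd.1 ∉ p.support := by
    intro hv
    exact not_farSide_fst hT h ⟨p.takeUntil _ hv⟩
  refine ⟨SimpleGraph.Walk.cons h.adj (p.mapLe (SimpleGraph.deleteEdges_le _)), ?_, ?_⟩
  · rw [SimpleGraph.Walk.cons_isPath_iff]
    refine ⟨?_, ?_⟩
    · simpa using hp
    · simpa using hv
  · simp

theorem farSide_unique {V : Type*} {T : SimpleGraph V} (hT : T.IsTree) (h k : T.Dart) (u : V)
    (hk : h.toProd.1 = k.toProd.1) (hu : farSide T h u) (ku : farSide T k u) : h = k := by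
  obtain ⟨p, hp, hp2⟩ := farSide_path hT h u hu
  obtain ⟨q, hq, hq2⟩ := farSide_path hT k u ku
  obtain ⟨⟨a, b⟩, hab⟩ := h
  obtain ⟨⟨c, d⟩, hcd⟩ := k
  simp only at hk p q hp hq hp2 hq2
  subst hk
  have hsub := hT.isAcyclic.subsingleton_path a u
  have hpq : p = q :=
    congrArg Subtype.val (hsub.elim (⟨p, hp⟩ : T.Path a u) (⟨q, hq⟩ : T.Path a u))
  subst hpq
  have : b = d := hp2.symm.trans hq2
  subst this
  rfl

theorem farSide_exists {V : Type*} {T : SimpleGraph V} (hT : T.IsTree) (v u : V) (huv : u ≠ v) :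
    ∃ h : T.Dart, h.toProd.1 = v ∧ farSide T h u := by
  obtain ⟨p, hp⟩ := (hT.connected.preconnected v u).exists_isPath
  cases p with
  | nil => exact absurd rfl huv
  | @cons _ w _ hvw p =>
    rw [SimpleGraph.Walk.cons_isPath_iff] at hp
    refine ⟨⟨(v, w), hvw⟩, rfl, ?_⟩
    refine ⟨p.toDeleteEdges _ ?_⟩
    intro e he hee
    have : e = s(v, w) := hee
    subst this
    exact hp.2 (p.fst_mem_support_of_mem_edges he)

theorem farSide_adj {V : Type*} {T : SimpleGraph V} (h : T.Dart) (a b : V)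
    (hab : T.Adj a b) (hne : s(a, b) ≠ h.edge) (ha : farSide T h a) : farSide T h b := by
  have hadj : (T.deleteEdges {h.edge}).Adj a b := by
    simp [SimpleGraph.deleteEdges_adj, hab, hne]
  exact SimpleGraph.Reachable.trans ha hadj.reachable

/-- the edge `e` belongs to `T_h`. -/
def farEdge {V : Type*} (T : SimpleGraph V) (h : T.Dart) (e : Sym2 V) : Prop :=
  e = h.edge ∨ ∀ u ∈ e, farSide T h u

theorem subtreeEdges_eq {V : Type*} [Fintype V] (T : SimpleGraph V) (h : T.Dart) :
    subtreeEdges T h = ∑ u : V, if farSide T h u then 1 else 0 := by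
  unfold subtreeEdges
  rw [Nat.card_eq_fintype_card, Fintype.card_subtype, Finset.card_filter]
  apply Finset.sum_congr rfl
  intro u _
  unfold farSide
  congr

theorem subtreeColorSum_eq {V : Type*} [Fintype V] {d : ℕ} (T : SimpleGraph V)
    (cE : Sym2 V → Finset (Fin d)) (h : T.Dart) :
    subtreeColorSum T cE h =
      ∑ e ∈ T.edgeFinset, if farEdge T h e then ((cE e).card : ℚ) else 0 := by
  unfold subtreeColorSum
  have hmem : h.edge ∈ T.edgeFinset := by
    rw [SimpleGraph.mem_edgeFinset]; exact h.edge_mem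
  rw [← Finset.add_sum_erase _ _ hmem, if_pos (show farEdge T h h.edge from Or.inl rfl),
    ← Finset.sum_filter]
  congr 1
  apply Finset.sum_congr _ (fun _ _ => rfl)
  ext e
  rw [Finset.mem_filter, Finset.mem_filter, Finset.mem_erase]
  unfold farEdge farSide
  tauto

theorem subtreeEdges_add_symm {V : Type*} [Fintype V] {T : SimpleGraph V} (hT : T.IsTree)
    (h : T.Dart) : subtreeEdges T h + subtreeEdges T h.symm = T.edgeFinset.card + 1 := by
  rw [hT.card_edgeFinset, subtreeEdges_eq, subtreeEdges_eq, ← Finset.sum_add_distrib]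
  rw [Finset.sum_congr rfl (g := fun _ => 1)]
  · simp
  · intro u _
    have := farSide_symm_iff hT h u
    by_cases hu : farSide T h u <;> simp [this, hu]

theorem farEdge_symm_iff {V : Type*} {T : SimpleGraph V} (hT : T.IsTree) (h : T.Dart)
    (e : Sym2 V) (he : e ∈ T.edgeSet) (hne : e ≠ h.edge) :
    farEdge T h.symm e ↔ ¬ farEdge T h e := by
  have hes : h.symm.edge = h.edge := SimpleGraph.Dart.edge_symm h
  induction e with
  | _ a b =>
  have hab : T.Adj a b := he
  have h1 : farSide T h a ↔ farSide T h b :=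
    ⟨farSide_adj h a b hab hne, farSide_adj h b a hab.symm (by rwa [Sym2.eq_swap])⟩
  simp only [farEdge, hes, hne, false_or, Sym2.mem_iff, forall_eq_or_imp, forall_eq,
    farSide_symm_iff hT]
  tauto

theorem subtreeColorSum_add_symm {V : Type*} [Fintype V] {d : ℕ} {T : SimpleGraph V}
    (hT : T.IsTree) (cE : Sym2 V → Finset (Fin d)) (h : T.Dart) :
    subtreeColorSum T cE h + subtreeColorSum T cE h.symm =
      ∑ e ∈ T.edgeFinset, ((cE e).card : ℚ) + ((cE h.edge).card : ℚ) := by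
  have hes : h.symm.edge = h.edge := SimpleGraph.Dart.edge_symm h
  have hmem : h.edge ∈ T.edgeFinset := by
    rw [SimpleGraph.mem_edgeFinset]; exact h.edge_mem
  rw [subtreeColorSum_eq, subtreeColorSum_eq, ← Finset.sum_add_distrib,
    ← Finset.add_sum_erase _ _ hmem, ← Finset.add_sum_erase _ _ hmem,
    if_pos (show farEdge T h h.edge from Or.inl rfl),
    if_pos (show farEdge T h.symm h.edge from Or.inl hes.symm)]
  rw [Finset.sum_congr rfl (g := fun e => ((cE e).card : ℚ))]
  · ring
  · intro e he
    rw [Finset.mem_erase, SimpleGraph.mem_edgeFinset] at he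
    have := farEdge_symm_iff hT h e he.2 he.1
    by_cases hu : farEdge T h e <;> simp [this, hu]

theorem sum_subtreeEdges {V : Type*} [Fintype V] {T : SimpleGraph V} (hT : T.IsTree) (v : V) :
    ∑ h ∈ Finset.univ.filter (fun h : T.Dart => h.toProd.1 = v), subtreeEdges T h
      = T.edgeFinset.card := by
  have hc := hT.card_edgeFinset
  simp only [subtreeEdges_eq]
  rw [Finset.sum_comm]
  have : ∀ u : V, (∑ h ∈ Finset.univ.filter (fun h : T.Dart => h.toProd.1 = v),
      if farSide T h u then 1 else 0) = if u = v then 0 else 1 := by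
    intro u
    split_ifs with huv
    · apply Finset.sum_eq_zero
      intro h hh
      rw [Finset.mem_filter] at hh
      rw [if_neg]
      rw [huv, ← hh.2]
      exact not_farSide_fst hT h
    · obtain ⟨k, hk, hku⟩ := farSide_exists hT v u huv
      rw [Finset.sum_eq_single k]
      · rw [if_pos hku]
      · intro h hh hne
        rw [Finset.mem_filter] at hh
        rw [if_neg]
        intro hu
        exact hne (farSide_unique hT h k u (hh.2.trans hk.symm) hu hku)
      · intro hkmem
        exact absurd (by simp [hk]) hkmem
  rw [Finset.sum_congr rfl (fun u _ => this u), ← Finset.add_sum_erase _ _ (Finset.mem_univ v),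
    if_pos rfl, Finset.sum_congr rfl (g := fun _ => 1)]
  · simp [Finset.card_erase_of_mem]
    omega
  · intro u hu
    rw [if_neg (Finset.ne_of_mem_erase hu)]

theorem farEdge_existsUnique {V : Type*} {T : SimpleGraph V} (hT : T.IsTree) (v : V)
    (e : Sym2 V) (he : e ∈ T.edgeSet) :
    ∃ h : T.Dart, h.toProd.1 = v ∧ farEdge T h e ∧
      ∀ k : T.Dart, k.toProd.1 = v → farEdge T k e → k = h := by
  by_cases hv : v ∈ e
  · obtain ⟨b, rfl⟩ := hv
    refine ⟨⟨(v, b), he⟩, rfl, Or.inl rfl, ?_⟩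
    intro k hk hke
    rcases hke with hke | hke
    · obtain ⟨⟨x, y⟩, hxy⟩ := k
      simp only at hk
      subst hk
      have h2 : s(x, b) = s(x, y) := hke
      have : b = y := Sym2.congr_right.1 h2
      subst this
      rfl
    · exfalso
      apply not_farSide_fst hT k
      rw [hk]
      exact hke v (Sym2.mem_mk_left _ _)
  · induction e with
    | _ a b =>
    have hab : T.Adj a b := he
    have hne : ∀ k : T.Dart, k.toProd.1 = v → s(a, b) ≠ k.edge := by
      intro k hk hh
      apply hv
      rw [hh, ← hk]
      exact Sym2.mem_mk_left _ _
    have hav : a ≠ v := by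
      rintro rfl
      exact hv (Sym2.mem_mk_left _ _)
    obtain ⟨h, hh, hu⟩ := farSide_exists hT v a hav
    refine ⟨h, hh, Or.inr ?_, ?_⟩
    · intro u humem
      rcases Sym2.mem_iff.1 humem with rfl | rfl
      · exact hu
      · exact farSide_adj h _ _ hab (hne h hh) hu
    · intro k hk hke
      have := hke.resolve_left (hne k hk) a (Sym2.mem_mk_left _ _)
      exact farSide_unique hT k h a (hk.trans hh.symm) this hu

theorem sum_subtreeColorSum {V : Type*} [Fintype V] {d : ℕ} {T : SimpleGraph V}
    (hT : T.IsTree) (cE : Sym2 V → Finset (Fin d)) (v : V) :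
    ∑ h ∈ Finset.univ.filter (fun h : T.Dart => h.toProd.1 = v), subtreeColorSum T cE h
      = ∑ e ∈ T.edgeFinset, ((cE e).card : ℚ) := by
  simp only [subtreeColorSum_eq]
  rw [Finset.sum_comm]
  apply Finset.sum_congr rfl
  intro e he
  rw [SimpleGraph.mem_edgeFinset] at he
  obtain ⟨k, hk, hke, huniq⟩ := farEdge_existsUnique hT v e he
  rw [Finset.sum_eq_single k]
  · rw [if_pos hke]
  · intro h hh hne
    rw [Finset.mem_filter] at hh
    rw [if_neg]
    intro hu
    exact hne (huniq h hh.2 hu)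
  · intro hkmem
    exact absurd (by simp [hk]) hkmem

theorem subtreeEdges_lt {V : Type*} [Fintype V] {T : SimpleGraph V} (hT : T.IsTree)
    (h k : T.Dart) (hk : k.toProd.1 = h.toProd.2) (hne : k ≠ h.symm) :
    subtreeEdges T k < subtreeEdges T h := by
  rw [subtreeEdges_eq, subtreeEdges_eq, ← Finset.card_filter, ← Finset.card_filter]
  apply Finset.card_lt_card
  rw [Finset.ssubset_iff_of_subset]
  · refine ⟨h.toProd.2, ?_, ?_⟩
    · simpa using farSide_snd T h
    · simpa [← hk] using not_farSide_fst hT k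
  · intro u hu
    simp only [Finset.mem_filter, Finset.mem_univ, true_and] at hu ⊢
    by_contra hcon
    exact hne (farSide_unique hT k h.symm u hk hu ((farSide_symm_iff hT h u).2 hcon))

theorem flow_zero {V : Type*} [Fintype V] {T : SimpleGraph V} (hT : T.IsTree) (δ : T.Dart → ℚ)
    (h1 : ∀ h, δ h + δ h.symm = 0)
    (h2 : ∀ v : V, ∑ h ∈ Finset.univ.filter (fun h : T.Dart => h.toProd.1 = v), δ h = 0) :
    ∀ (n : ℕ) (h : T.Dart), subtreeEdges T h = n → δ h = 0 := by
  intro n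
  induction n using Nat.strong_induction_on with
  | _ n ih =>
  intro h hn
  have hs := h2 h.toProd.2
  rw [Finset.sum_eq_single h.symm] at hs
  · have := h1 h
    linarith
  · intro k hk hne
    rw [Finset.mem_filter] at hk
    exact ih _ (hn ▸ subtreeEdges_lt hT h k hk.2 hne) k rfl
  · intro hkmem
    exact absurd (by simp) hkmem

/-- for a tree `T` with edge color sets `|C_e| < d/2` and
`s = −d(V−2)/2 + Σ_e |C_e|` (where `2·E(T) = V − 2`), the coefficients
`η_h = (d + 2s/(V−2))·E(T_h) − Σ_{e⊂T_h} |C_e|` form the unique solution of the system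
(i) `η_h + η_{h'} = d + 2s/(V−2) − |C_e|` for every edge `e = {h, h'}`, and
(ii) `Σ_{h_v} η_{h_v} = 0` for every vertex `v`. -/
theorem eta_unique_solution {α : Type*} [Fintype α] (T : SimpleGraph α)
    (hT : T.IsTree) (d V : ℕ) (hd : 2 < d) (hV4 : 4 ≤ V)
    (hV : 2 * T.edgeFinset.card + 2 = V)
    (cE : Sym2 α → Finset (Fin d))
    (hcE : ∀ e ∈ T.edgeSet, 2 * (cE e).card < d)
    (s : ℚ)
    (hs : s = -((d : ℚ) * ((V : ℚ) - 2)) / 2 + ∑ e ∈ T.edgeFinset, ((cE e).card : ℚ)) :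
    ∀ η : T.Dart → ℚ,
      ((∀ h : T.Dart,
          η h + η h.symm = (d : ℚ) + 2 * s / ((V : ℚ) - 2) - ((cE h.edge).card : ℚ)) ∧
        (∀ v : α, ∑ h ∈ Finset.univ.filter (fun h : T.Dart => h.toProd.1 = v), η h = 0)) ↔
      η = fun h =>
        ((d : ℚ) + 2 * s / ((V : ℚ) - 2)) * (subtreeEdges T h : ℚ)
          - subtreeColorSum T cE h := by
  have hE : (V : ℚ) - 2 = 2 * (T.edgeFinset.card : ℚ) := by
    rw [← hV]; push_cast; ring
  have hEpos : (T.edgeFinset.card : ℚ) ≠ 0 := by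
    have : T.edgeFinset.card ≠ 0 := by omega
    exact_mod_cast this
  have hc : ((d : ℚ) + 2 * s / ((V : ℚ) - 2)) * (T.edgeFinset.card : ℚ)
      = ∑ e ∈ T.edgeFinset, ((cE e).card : ℚ) := by
    rw [hE, hs, hE]
    field_simp
    ring
  generalize (d : ℚ) + 2 * s / ((V : ℚ) - 2) = c at hc ⊢
  have sol1 : ∀ h : T.Dart, (c * (subtreeEdges T h : ℚ) - subtreeColorSum T cE h)
      + (c * (subtreeEdges T h.symm : ℚ) - subtreeColorSum T cE h.symm)
      = c - ((cE h.edge).card : ℚ) := by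
    intro h
    have e1 : (subtreeEdges T h : ℚ) + (subtreeEdges T h.symm : ℚ)
        = (T.edgeFinset.card : ℚ) + 1 := by exact_mod_cast subtreeEdges_add_symm hT h
    have e2 := subtreeColorSum_add_symm hT cE h
    linear_combination c * e1 - e2 + hc
  have sol2 : ∀ v : α, ∑ h ∈ Finset.univ.filter (fun h : T.Dart => h.toProd.1 = v),
      (c * (subtreeEdges T h : ℚ) - subtreeColorSum T cE h) = 0 := by
    intro v
    rw [Finset.sum_sub_distrib, ← Finset.mul_sum, sum_subtreeColorSum hT cE v, ← hc,
      ← Nat.cast_sum, sum_subtreeEdges hT v, sub_self]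
  intro η
  constructor
  · rintro ⟨h1, h2⟩
    funext h
    have := flow_zero hT
      (fun h => η h - (c * (subtreeEdges T h : ℚ) - subtreeColorSum T cE h))
      (fun h => by
        have a := h1 h
        have b := sol1 h
        linear_combination a - b)
      (fun v => by rw [Finset.sum_sub_distrib, h2 v, sol2 v, sub_self]) _ h rfl
    linear_combination this
  · rintro rfl
    exact ⟨sol1, sol2⟩
end
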